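/- arXiv:1509.09253 — 6 statements merged into one kernel-verified Lean document; each statement's English description precedes it below -/
import Mathlib

section
/- Suppose n ≥ 3. For every nonzero vector v ∈ V there exists an automorphism φ of Fₙ with q ∘ φ = q (so in particular φ(K) = K and φ induces the identity automorphism of G) such that the set of iterates {φ̃^d v : d ∈ ℤ} ⊆ V is infinite. -/
open TensorProduct

/-- The restriction of an automorphism `φ` of the free group to the kernel `K = ker q`,
given that `q ∘ φ = q`, as a group automorphism of `K`. -/
def kerRestrict {n : ℕ} {G : Type*} [Group G] (q : FreeGroup (Fin n) →* G)
    (φ : FreeGroup (Fin n) ≃* FreeGroup (Fin n))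
    (hφ : q.comp φ.toMonoidHom = q) : q.ker ≃* q.ker where
  toFun k := ⟨φ k, by
    have h : q (φ k) = q k := DFunLike.congr_fun hφ (k : FreeGroup (Fin n))
    have hk : q (k : FreeGroup (Fin n)) = 1 := k.2
    exact MonoidHom.mem_ker.2 (h.trans hk)⟩
  invFun k := ⟨φ.symm k, by
    have h : q (φ (φ.symm (k : FreeGroup (Fin n)))) = q (φ.symm (k : FreeGroup (Fin n))) :=
      DFunLike.congr_fun hφ (φ.symm (k : FreeGroup (Fin n)))
    rw [φ.apply_symm_apply] at h
    have hk : q (k : FreeGroup (Fin n)) = 1 := k.2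
    exact MonoidHom.mem_ker.2 (h.symm.trans hk)⟩
  left_inv k := by ext; simp
  right_inv k := by ext; simp
  map_mul' x y := by ext; simp

/-- The induced `ℚ`-linear automorphism `φ̃` of `V = ℚ ⊗[ℤ] H₁` where
`H₁ = Additive (Abelianization K)` is the abelianized kernel. -/
noncomputable def inducedAuto {n : ℕ} {G : Type*} [Group G] (q : FreeGroup (Fin n) →* G)
    (φ : FreeGroup (Fin n) ≃* FreeGroup (Fin n))
    (hφ : q.comp φ.toMonoidHom = q) :
    (ℚ ⊗[ℤ] Additive (Abelianization q.ker)) ≃ₗ[ℚ] (ℚ ⊗[ℤ] Additive (Abelianization q.ker)) :=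
  LinearEquiv.baseChange ℤ ℚ _ _
    ((MulEquiv.toAdditive ((kerRestrict q φ hφ).abelianizationCongr)).toIntLinearEquiv)

namespace MovingHomology

open MonoidAlgebra

variable {n : ℕ} {G : Type} [Group G]

/-- The composite of `q` with the inclusion of `G` in its group algebra. -/
noncomputable def gam (q : FreeGroup (Fin n) →* G) : FreeGroup (Fin n) →* MonoidAlgebra ℚ G :=
  (MonoidAlgebra.of ℚ G).comp q

theorem gam_inv_mul (q : FreeGroup (Fin n) →* G) (u : FreeGroup (Fin n)) :
    gam q u⁻¹ * gam q u = 1 := by rw [← map_mul]; simp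

theorem gam_mul_inv (q : FreeGroup (Fin n) →* G) (u : FreeGroup (Fin n)) :
    gam q u * gam q u⁻¹ = 1 := by rw [← map_mul]; simp

/-- Affine action of the free group on `ℚ[G]ⁿ` encoding Fox calculus. -/
noncomputable def rho (q : FreeGroup (Fin n) →* G) :
    FreeGroup (Fin n) →* Equiv.Perm (Fin n → MonoidAlgebra ℚ G) :=
  FreeGroup.lift fun i =>
    { toFun := fun x => gam q (FreeGroup.of i) • x + Pi.single i 1
      invFun := fun x => gam q (FreeGroup.of i)⁻¹ • (x - Pi.single i 1)
      left_inv := fun x => by simp [smul_smul, gam_inv_mul]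
      right_inv := fun x => by simp [smul_smul, gam_mul_inv] }

/-- Fox derivatives. -/
noncomputable def fox (q : FreeGroup (Fin n) →* G) (u : FreeGroup (Fin n)) :
    Fin n → MonoidAlgebra ℚ G := rho q u 0

theorem rho_of (q : FreeGroup (Fin n) →* G) (i : Fin n) (x : Fin n → MonoidAlgebra ℚ G) :
    rho q (FreeGroup.of i) x = gam q (FreeGroup.of i) • x + Pi.single i 1 := by
  simp [rho]

theorem fox_of (q : FreeGroup (Fin n) →* G) (i : Fin n) :
    fox q (FreeGroup.of i) = Pi.single i 1 := by
  simp [fox, rho_of]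

theorem rho_apply (q : FreeGroup (Fin n) →* G) (u : FreeGroup (Fin n)) :
    ∀ x, rho q u x = gam q u • x + fox q u := by
  induction u using FreeGroup.induction_on with
  | C1 => intro x; simp [fox]
  | of i => intro x; rw [rho_of, fox_of]
  | inv_of i ih =>
    have key : ∀ x, rho q (FreeGroup.of i)⁻¹ x
        = gam q (FreeGroup.of i)⁻¹ • (x - Pi.single i 1) := by
      intro x
      rw [map_inv, Equiv.Perm.inv_eq_iff_eq, rho_of, smul_smul, gam_mul_inv]
      simp
    intro x
    rw [fox, key, key, ← smul_add]
    congr 1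
    abel
  | mul u v hu hv =>
    intro x
    have h : fox q (u * v) = gam q u • fox q v + fox q u := by
      rw [fox, map_mul, Equiv.Perm.mul_apply, hu]; rfl
    rw [h, map_mul, Equiv.Perm.mul_apply, hv, hu, smul_add, map_mul, smul_smul, add_assoc]

theorem fox_mul (q : FreeGroup (Fin n) →* G) (u v : FreeGroup (Fin n)) :
    fox q (u * v) = fox q u + gam q u • fox q v := by
  rw [fox, map_mul, Equiv.Perm.mul_apply, rho_apply, add_comm]; rfl

theorem fox_one (q : FreeGroup (Fin n) →* G) : fox q 1 = 0 := by simp [fox]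

theorem fox_inv (q : FreeGroup (Fin n) →* G) (u : FreeGroup (Fin n)) :
    fox q u⁻¹ = - (gam q u⁻¹ • fox q u) := by
  have h := fox_mul q u⁻¹ u
  rw [inv_mul_cancel, fox_one] at h
  exact eq_neg_of_add_eq_zero_left h.symm

theorem gam_ker (q : FreeGroup (Fin n) →* G) {u : FreeGroup (Fin n)} (h : q u = 1) :
    gam q u = 1 := by simp [gam, h, MonoidAlgebra.one_def]

/-- The subgroup generated by all generators except the `i`-th. -/
def others (i : Fin n) : Subgroup (FreeGroup (Fin n)) :=
  Subgroup.closure (FreeGroup.of '' {i}ᶜ)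

theorem fox_others (q : FreeGroup (Fin n) →* G) (i : Fin n) {w : FreeGroup (Fin n)}
    (hw : w ∈ others i) : fox q w i = 0 := by
  induction hw using Subgroup.closure_induction with
  | mem x hx =>
    obtain ⟨j, hj, rfl⟩ := hx
    rw [fox_of, Pi.single_eq_of_ne]
    exact fun h => hj h.symm
  | one => simp [fox_one]
  | mul x y _ _ hx hy => simp [fox_mul, hx, hy]
  | inv x _ hx => simp [fox_inv, hx]

/-- The endomorphism `aᵢ ↦ aᵢ w`, other generators fixed. -/
def tv (i : Fin n) (w : FreeGroup (Fin n)) : FreeGroup (Fin n) →* FreeGroup (Fin n) :=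
  FreeGroup.lift (Function.update FreeGroup.of i (FreeGroup.of i * w))

theorem tv_of_self (i : Fin n) (w : FreeGroup (Fin n)) :
    tv i w (FreeGroup.of i) = FreeGroup.of i * w := by simp [tv]

theorem tv_of_ne (i : Fin n) (w : FreeGroup (Fin n)) {j : Fin n} (h : j ≠ i) :
    tv i w (FreeGroup.of j) = FreeGroup.of j := by simp [tv, h]

theorem tv_others (i : Fin n) (w : FreeGroup (Fin n)) {u : FreeGroup (Fin n)}
    (hu : u ∈ others i) : tv i w u = u := by
  induction hu using Subgroup.closure_induction with
  | mem x hx =>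
    obtain ⟨j, hj, rfl⟩ := hx
    exact tv_of_ne i w hj
  | one => simp
  | mul x y _ _ hx hy => simp [hx, hy]
  | inv x _ hx => simp [hx]

theorem tv_comp (i : Fin n) (w w' : FreeGroup (Fin n)) (hw' : w' ∈ others i) (h : w * w' = 1) :
    (tv i w).comp (tv i w') = MonoidHom.id _ := by
  ext j
  by_cases hj : j = i
  · subst hj
    simp [tv_of_self, tv_others j w hw', mul_assoc, h]
  · simp [tv_of_ne i _ hj]

/-- The transvection as an automorphism. -/
def tvEquiv (i : Fin n) (w : FreeGroup (Fin n)) (hw : w ∈ others i) :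
    FreeGroup (Fin n) ≃* FreeGroup (Fin n) :=
  MonoidHom.toMulEquiv (tv i w) (tv i w⁻¹)
    (tv_comp i w⁻¹ w hw (by simp))
    (tv_comp i w w⁻¹ (inv_mem hw) (by simp))

theorem tvEquiv_apply (i : Fin n) (w : FreeGroup (Fin n)) (hw : w ∈ others i)
    (u : FreeGroup (Fin n)) : tvEquiv i w hw u = tv i w u := rfl

theorem q_tv (q : FreeGroup (Fin n) →* G) (i : Fin n) (w : FreeGroup (Fin n)) (hqw : q w = 1)
    (u : FreeGroup (Fin n)) : q (tv i w u) = q u := by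
  have : q.comp (tv i w) = q := by
    ext j
    by_cases hj : j = i
    · subst hj; simp [tv_of_self, hqw]
    · simp [tv_of_ne i w hj]
  exact DFunLike.congr_fun this u

theorem fox_tv (q : FreeGroup (Fin n) →* G) (i : Fin n) (w : FreeGroup (Fin n)) (hqw : q w = 1)
    (u : FreeGroup (Fin n)) :
    fox q (tv i w u) = fox q u + (fox q u i * gam q (FreeGroup.of i)) • fox q w := by
  have hg : ∀ u, gam q (tv i w u) = gam q u := fun u => by simp [gam, q_tv q i w hqw u]
  induction u using FreeGroup.induction_on with
  | C1 => simp [fox_one]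
  | of j =>
    by_cases hj : j = i
    · subst hj; simp [tv_of_self, fox_mul, fox_of]
    · rw [tv_of_ne i w hj, fox_of, Pi.single_eq_of_ne (Ne.symm hj)]; simp
  | inv_of j ih =>
    rw [map_inv, fox_inv, ← map_inv, hg, ih, fox_inv]
    simp only [Pi.neg_apply, Pi.smul_apply, smul_eq_mul, smul_add, smul_smul, neg_mul, neg_smul,
      neg_add, mul_assoc]
  | mul u v hu hv =>
    rw [map_mul, fox_mul, hu, hv, hg, fox_mul]
    simp only [Pi.add_apply, Pi.smul_apply, smul_eq_mul, smul_add, smul_smul, add_mul, add_smul,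
      mul_assoc]
    abel

/-- Fox calculus on the kernel, as a homomorphism. -/
noncomputable def foxKer (q : FreeGroup (Fin n) →* G) :
    q.ker →* Multiplicative (Fin n → MonoidAlgebra ℚ G) where
  toFun k := Multiplicative.ofAdd (fox q k)
  map_one' := by simp [fox_one]
  map_mul' x y := by
    rw [Subgroup.coe_mul, fox_mul, gam_ker q x.2, one_smul, ofAdd_add]

/-- The Magnus embedding of the homology of the cover. -/
noncomputable def magnus (q : FreeGroup (Fin n) →* G) :
    (ℚ ⊗[ℤ] Additive (Abelianization q.ker)) →ₗ[ℚ] (Fin n → MonoidAlgebra ℚ G) :=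
  LinearMap.liftBaseChange ℚ
    (AddMonoidHom.toIntLinearMap (MonoidHom.toAdditiveLeft (Abelianization.lift (foxKer q))))

/-- The homology class of an element of the kernel. -/
noncomputable def cls (q : FreeGroup (Fin n) →* G) (k : q.ker) :
    ℚ ⊗[ℤ] Additive (Abelianization q.ker) :=
  1 ⊗ₜ Additive.ofMul (Abelianization.of k)

theorem cls_mul (q : FreeGroup (Fin n) →* G) (k l : q.ker) :
    cls q (k * l) = cls q k + cls q l := by
  simp [cls, TensorProduct.tmul_add]

theorem cls_inv (q : FreeGroup (Fin n) →* G) (k : q.ker) :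
    cls q k⁻¹ = - cls q k := by
  simp [cls, TensorProduct.tmul_neg]

theorem magnus_cls (q : FreeGroup (Fin n) →* G) (k : q.ker) : magnus q (cls q k) = fox q k := by
  simp [magnus, cls, foxKer]

theorem hom_ext_cls (q : FreeGroup (Fin n) →* G) {W : Type*} [AddCommGroup W] [Module ℚ W]
    (f g : (ℚ ⊗[ℤ] Additive (Abelianization q.ker)) →ₗ[ℚ] W)
    (h : ∀ k, f (cls q k) = g (cls q k)) : f = g := by
  apply TensorProduct.AlgebraTensorModule.curry_injective
  ext x
  obtain ⟨k, hk⟩ := QuotientGroup.mk_surjective (Additive.toMul x)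
  have : x = Additive.ofMul (Abelianization.of k) := by
    apply Additive.toMul.injective; exact hk.symm
  subst this
  exact h k

theorem induced_cls (q : FreeGroup (Fin n) →* G) (φ : FreeGroup (Fin n) ≃* FreeGroup (Fin n))
    (hφ : q.comp φ.toMonoidHom = q) (k : q.ker) :
    inducedAuto q φ hφ (cls q k) = cls q (kerRestrict q φ hφ k) := by
  simp [inducedAuto, cls]

theorem magnus_induced (q : FreeGroup (Fin n) →* G) (i : Fin n) (w : FreeGroup (Fin n))
    (hw : w ∈ others i) (hqw : q w = 1) (hφ : q.comp (tvEquiv i w hw).toMonoidHom = q)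
    (v : ℚ ⊗[ℤ] Additive (Abelianization q.ker)) :
    magnus q (inducedAuto q (tvEquiv i w hw) hφ v)
      = magnus q v + (magnus q v i * gam q (FreeGroup.of i)) • fox q w := by
  let T : (Fin n → MonoidAlgebra ℚ G) →ₗ[ℚ] (Fin n → MonoidAlgebra ℚ G) :=
    { toFun := fun x => x + (x i * gam q (FreeGroup.of i)) • fox q w
      map_add' := fun x y => by
        simp only [Pi.add_apply, add_mul, add_smul]; abel
      map_smul' := fun c x => by
        simp only [Pi.smul_apply, RingHom.id_apply, smul_add, smul_mul_assoc, smul_assoc] }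
  have : (magnus q).comp (inducedAuto q (tvEquiv i w hw) hφ).toLinearMap
      = T.comp (magnus q) := by
    apply hom_ext_cls
    intro k
    have := fox_tv q i w hqw k
    simp only [LinearMap.comp_apply, LinearEquiv.coe_coe, induced_cls, magnus_cls]
    exact this
  exact LinearMap.congr_fun this v

/-- Schreier generator attached to a section of `q`. -/
def schreier (q : FreeGroup (Fin n) →* G) (σ : G → FreeGroup (Fin n)) (hσ : ∀ g, q (σ g) = g)
    (g : G) (u : FreeGroup (Fin n)) : q.ker :=
  ⟨σ g * u * (σ (g * q u))⁻¹, by simp [MonoidHom.mem_ker, hσ]⟩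

theorem schreier_mul (q : FreeGroup (Fin n) →* G) (σ : G → FreeGroup (Fin n))
    (hσ : ∀ g, q (σ g) = g) (g : G) (u v : FreeGroup (Fin n)) :
    schreier q σ hσ g (u * v) = schreier q σ hσ g u * schreier q σ hσ (g * q u) v := by
  ext
  simp [schreier, mul_assoc]

/-- Left inverse of the Magnus embedding. -/
noncomputable def retr (q : FreeGroup (Fin n) →* G) (σ : G → FreeGroup (Fin n))
    (hσ : ∀ g, q (σ g) = g) :
    (Fin n → MonoidAlgebra ℚ G) →ₗ[ℚ] (ℚ ⊗[ℤ] Additive (Abelianization q.ker)) :=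
  LinearMap.lsum ℚ (fun _ => MonoidAlgebra ℚ G) ℚ fun i =>
    (Finsupp.linearCombination ℚ
      (fun g => cls q (schreier q σ hσ g (FreeGroup.of i)))).comp
        (MonoidAlgebra.coeffLinearEquiv ℚ).toLinearMap

theorem retr_fox (q : FreeGroup (Fin n) →* G) (σ : G → FreeGroup (Fin n))
    (hσ : ∀ g, q (σ g) = g) (u : FreeGroup (Fin n)) :
    ∀ g, retr q σ hσ (MonoidAlgebra.of ℚ G g • fox q u) = cls q (schreier q σ hσ g u) := by
  have hone : ∀ g, cls q (schreier q σ hσ g 1) = 0 := fun g => by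
    have := cls_mul q (schreier q σ hσ g 1) (schreier q σ hσ g 1)
    have h2 := schreier_mul q σ hσ g 1 1
    simp only [map_one, mul_one] at h2
    rw [← h2] at this
    simpa using this
  have hof : ∀ i g, retr q σ hσ (MonoidAlgebra.of ℚ G g • fox q (FreeGroup.of i))
      = cls q (schreier q σ hσ g (FreeGroup.of i)) := by
    intro i g
    rw [fox_of, ← Pi.single_smul, smul_eq_mul, mul_one]
    rw [retr, LinearMap.lsum_piSingle]
    simp
  induction u using FreeGroup.induction_on with
  | C1 => intro g; rw [hone, fox_one]; simp
  | of i => exact hof i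
  | inv_of i ih =>
    intro g
    have h1 := schreier_mul q σ hσ g (FreeGroup.of i)⁻¹ (FreeGroup.of i)
    have h2 := congrArg (cls q) h1
    rw [inv_mul_cancel, hone, cls_mul, ← hof] at h2
    rw [fox_inv, smul_neg, map_neg, smul_smul]
    have h3 : MonoidAlgebra.of ℚ G g * gam q (FreeGroup.of i)⁻¹
        = MonoidAlgebra.of ℚ G (g * q (FreeGroup.of i)⁻¹) := by
      rw [map_mul]; rfl
    rw [h3]
    exact (eq_neg_of_add_eq_zero_left h2.symm).symm
  | mul u v hu hv =>
    intro g
    have h3 : MonoidAlgebra.of ℚ G g * gam q u = MonoidAlgebra.of ℚ G (g * q u) := by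
      rw [map_mul]; rfl
    rw [fox_mul, smul_add, map_add, hu, smul_smul, h3, hv, schreier_mul, cls_mul]

theorem magnus_injective (q : FreeGroup (Fin n) →* G) (hq : Function.Surjective q) :
    Function.Injective (magnus q) := by
  choose σ hσ using hq
  have : (retr q σ hσ).comp (magnus q) = LinearMap.id := by
    apply hom_ext_cls
    intro k
    have h := retr_fox q σ hσ k 1
    rw [map_one, one_smul] at h
    have hs : schreier q σ hσ 1 k
        = ⟨σ 1, by simp [MonoidHom.mem_ker, hσ]⟩ * k * (⟨σ 1, by simp [MonoidHom.mem_ker, hσ]⟩)⁻¹ := by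
      ext
      have hk : q k = 1 := k.2
      simp [schreier, hk]
    rw [LinearMap.comp_apply, magnus_cls, h, hs, cls_mul, cls_mul, cls_inv]
    simp
  exact Function.LeftInverse.injective (g := retr q σ hσ) (LinearMap.congr_fun this)

theorem exists_loop [Finite G] (q : FreeGroup (Fin n) →* G) (L : Subgroup (FreeGroup (Fin n)))
    (j k : Fin n) (hjk : j ≠ k) (hj : FreeGroup.of j ∈ L) (hk : FreeGroup.of k ∈ L)
    (y : MonoidAlgebra ℚ G) (hy : y ≠ 0) :
    ∃ w ∈ L, q w = 1 ∧ y • fox q w ≠ 0 := by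
  by_contra hcon
  push Not at hcon
  -- the value of `y • fox q u` depends only on `q u`
  have hdep : ∀ u ∈ L, ∀ u' ∈ L, q u = q u' → y • fox q u = y • fox q u' := by
    intro u hu u' hu' h
    have h1 : q (u * u'⁻¹) = 1 := by simp [h]
    have h2 : fox q u = fox q (u * u'⁻¹) + fox q u' := by
      conv_lhs => rw [show u = (u * u'⁻¹) * u' by group, fox_mul, gam_ker q h1, one_smul]
    rw [h2, smul_add, hcon _ (mul_mem hu (inv_mem hu')) h1, zero_add]
  have : Fintype (L.map q) := Fintype.ofFinite _
  have hτ : ∀ h : L.map q, ∃ u ∈ L, q u = h := fun h => Subgroup.mem_map.1 h.2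
  choose τ hτL hτq using hτ
  set S := ∑ h : L.map q, fox q (τ h) with hS
  have hfin : Module.Finite ℚ (MonoidAlgebra ℚ G) :=
    Module.Finite.equiv
      (MonoidAlgebra.coeffLinearEquiv ℚ : MonoidAlgebra ℚ G ≃ₗ[ℚ] (G →₀ ℚ)).symm
  let M : Submodule ℚ (MonoidAlgebra ℚ G) :=
    Submodule.span ℚ (Set.range fun u : L => y * gam q u)
  have hM : ∀ u ∈ L, y * gam q u ∈ M := fun u hu => Submodule.subset_span ⟨⟨u, hu⟩, rfl⟩
  have hyM : y ∈ M := by simpa using hM 1 (one_mem _)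
  let fS : MonoidAlgebra ℚ G →ₗ[ℚ] (Fin n → MonoidAlgebra ℚ G) :=
    (LinearMap.toSpanSingleton (MonoidAlgebra ℚ G) _ S).restrictScalars ℚ
  have hfS : ∀ m, fS m = m • S := fun m => rfl
  have hN : ∀ u ∈ L, y • fox q u ∈ M.map fS := by
    intro u hu
    have h1 : (y * gam q u) • S = y • S - (Fintype.card (L.map q) : ℚ) • (y • fox q u) := by
      have h2 : ∀ h : L.map q, (y * gam q u) • fox q (τ h)
          = y • fox q (τ (⟨q u, Subgroup.mem_map_of_mem q hu⟩ * h)) - y • fox q u := by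
        intro h
        rw [← hdep (u * τ h) (mul_mem hu (hτL h)) _ (hτL _) (by simp [hτq]), fox_mul, smul_add,
          smul_smul]
        abel
      rw [hS, Finset.smul_sum, Finset.sum_congr rfl (fun h _ => h2 h), Finset.sum_sub_distrib,
        Finset.smul_sum]
      have h3 := Equiv.sum_comp (Equiv.mulLeft (⟨q u, Subgroup.mem_map_of_mem q hu⟩ : L.map q))
          (fun h => y • fox q (τ h))
      simp only [Equiv.coe_mulLeft] at h3
      rw [h3]
      simp [← Nat.cast_smul_eq_nsmul ℚ]
    have hc : (Fintype.card (L.map q) : ℚ) ≠ 0 := by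
      exact_mod_cast Fintype.card_ne_zero
    refine ⟨(Fintype.card (L.map q) : ℚ)⁻¹ • (y - y * gam q u),
      M.smul_mem _ (M.sub_mem hyM (hM u hu)), ?_⟩
    rw [map_smul, hfS, sub_smul, h1, sub_sub_cancel, smul_smul, inv_mul_cancel₀ hc, one_smul]
  have hsing : ∀ l, FreeGroup.of l ∈ L → ∀ m ∈ M,
      (Pi.single l m : Fin n → MonoidAlgebra ℚ G) ∈ M.map fS := by
    intro l hl m hm
    have : M ≤ (M.map fS).comap (LinearMap.single ℚ (fun _ : Fin n => MonoidAlgebra ℚ G) l) := by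
      apply Submodule.span_le.2
      rintro _ ⟨u, rfl⟩
      change Pi.single l (y * gam q u) ∈ M.map fS
      have : (Pi.single l (y * gam q u) : Fin n → MonoidAlgebra ℚ G)
          = y • fox q (u * FreeGroup.of l) - y • fox q u := by
        rw [fox_mul, fox_of, smul_add, smul_smul, add_sub_cancel_left, ← Pi.single_smul,
          smul_eq_mul, mul_one]
      rw [this]
      exact Submodule.sub_mem _ (hN _ (mul_mem u.2 hl)) (hN _ u.2)
    exact this hm
  let ψ : (M × M) →ₗ[ℚ] (M.map fS) :=
    LinearMap.codRestrict _
      (LinearMap.coprod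
        ((LinearMap.single ℚ (fun _ : Fin n => MonoidAlgebra ℚ G) j).comp M.subtype)
        ((LinearMap.single ℚ (fun _ : Fin n => MonoidAlgebra ℚ G) k).comp M.subtype))
      (fun x => Submodule.add_mem _ (hsing j hj _ x.1.2) (hsing k hk _ x.2.2))
  have hψ : Function.Injective ψ := by
    rw [← LinearMap.ker_eq_bot, LinearMap.ker_eq_bot']
    rintro ⟨a, b⟩ hab
    have h : (Pi.single j (a : MonoidAlgebra ℚ G) + Pi.single k (b : MonoidAlgebra ℚ G) :
        Fin n → MonoidAlgebra ℚ G) = 0 := congrArg Subtype.val hab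
    have ha := congrFun h j
    have hb := congrFun h k
    simp [Pi.single_eq_of_ne hjk] at ha
    simp [Pi.single_eq_of_ne hjk.symm] at hb
    simp [ha, hb]
  have h1 := LinearMap.finrank_le_finrank_of_injective hψ
  have h2 := Submodule.finrank_map_le fS M
  rw [Module.finrank_prod] at h1
  have h3 : Module.finrank ℚ M = 0 := by omega
  rw [Submodule.finrank_eq_zero] at h3
  rw [h3] at hyM
  exact hy ((Submodule.mem_bot ℚ).1 hyM)

end MovingHomology

open MovingHomology in
/-- **Moving homology classes in covers** (Theorem 1.1, iterate form).
If `n ≥ 3` and `q : Fₙ → G` is a surjection onto a finite group with kernel `K`, then for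
every nonzero `v` in `V = ℚ ⊗ (K)ᵃᵇ` there is an automorphism `φ` of `Fₙ` with `q ∘ φ = q`
whose induced action on `V` has infinite orbit of iterates `{φ̃^d v : d ∈ ℤ}`. -/
theorem moving_homology_classes_in_covers (n : ℕ) (hn : 3 ≤ n)
    (G : Type) [Group G] [Finite G]
    (q : FreeGroup (Fin n) →* G) (hq : Function.Surjective q)
    (v : ℚ ⊗[ℤ] Additive (Abelianization q.ker)) (hv : v ≠ 0) :
    ∃ (φ : FreeGroup (Fin n) ≃* FreeGroup (Fin n)) (hφ : q.comp φ.toMonoidHom = q),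
      {w : ℚ ⊗[ℤ] Additive (Abelianization q.ker) |
        ∃ d : ℤ, ((inducedAuto q φ hφ) ^ d) v = w}.Infinite := by
  classical
  have hm : magnus q v ≠ 0 := fun h => hv (magnus_injective q hq (by rw [h, map_zero]))
  obtain ⟨i, hi⟩ := Function.ne_iff.1 hm
  have hy : magnus q v i * gam q (FreeGroup.of i) ≠ 0 := by
    intro h
    apply hi
    have := congrArg (· * gam q (FreeGroup.of i)⁻¹) h
    simpa [mul_assoc, gam_mul_inv] using this
  obtain ⟨j, k, hji, hki, hjk⟩ : ∃ j k : Fin n, j ≠ i ∧ k ≠ i ∧ j ≠ k := by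
    have h1 : 1 < (Finset.univ.erase i).card := by
      rw [Finset.card_erase_of_mem (Finset.mem_univ i), Finset.card_univ, Fintype.card_fin]
      omega
    obtain ⟨j, hj, k, hk, hjk⟩ := Finset.one_lt_card.1 h1
    exact ⟨j, k, Finset.ne_of_mem_erase hj, Finset.ne_of_mem_erase hk, hjk⟩
  obtain ⟨w, hw, hqw, hne⟩ := exists_loop q (others i) j k hjk
    (Subgroup.subset_closure ⟨j, hji, rfl⟩) (Subgroup.subset_closure ⟨k, hki, rfl⟩) _ hy
  have hφ : q.comp (tvEquiv i w hw).toMonoidHom = q :=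
    MonoidHom.ext fun u => q_tv q i w hqw u
  refine ⟨tvEquiv i w hw, hφ, ?_⟩
  have hit : ∀ d : ℕ, magnus q ((inducedAuto q (tvEquiv i w hw) hφ ^ d) v)
      = magnus q v + (d : ℚ) • ((magnus q v i * gam q (FreeGroup.of i)) • fox q w) := by
    intro d
    induction d with
    | zero => simp
    | succ d ih =>
      rw [pow_succ', LinearEquiv.mul_apply, magnus_induced q i w hw hqw hφ, ih]
      have h0 : (magnus q v + (d : ℚ) • ((magnus q v i * gam q (FreeGroup.of i)) • fox q w)) i
          = magnus q v i := by
        simp [fox_others q i hw]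
      rw [h0, Nat.cast_succ, add_smul, one_smul, add_assoc]
  refine Set.infinite_of_injective_forall_mem
    (f := fun d : ℕ => (inducedAuto q (tvEquiv i w hw) hφ ^ d) v) ?_ ?_
  · intro a b hab
    have h := congrArg (magnus q) hab
    simp only [hit] at h
    have h' := smul_left_injective ℚ hne (add_left_cancel h)
    exact_mod_cast h'
  · intro d
    exact ⟨d, by rw [zpow_natCast]⟩
end

section
/- Suppose n ≥ 3. For every nonzero vector v ∈ V the orbit set {φ̃ v : φ an automorphism of Fₙ with q ∘ φ = q} ⊆ V is infinite. -/
open TensorProduct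

namespace Fox

open MonoidAlgebra

/-- Every element of the rational group algebra of a finite group is von Neumann regular. -/
theorem regular {H : Type*} [Group H] [Finite H] (u : MonoidAlgebra ℚ H) :
    ∃ z, u = u * z * u := by
  have : NeZero (Nat.card H : ℚ) := ⟨by exact_mod_cast Nat.card_pos.ne'⟩
  obtain ⟨C, hC⟩ := exists_isCompl (Submodule.span (MonoidAlgebra ℚ H) {u})
  have h1 : (1 : MonoidAlgebra ℚ H) ∈ Submodule.span (MonoidAlgebra ℚ H) {u} ⊔ C := by
    rw [hC.sup_eq_top]; trivial
  obtain ⟨y, hy, c, hc, hyc⟩ := Submodule.mem_sup.1 h1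
  obtain ⟨z, rfl⟩ := Submodule.mem_span_singleton.1 hy
  refine ⟨z, ?_⟩
  have e : u * z * u + u * c = u := by
    rw [mul_assoc, ← mul_add]
    simp only [smul_eq_mul] at hyc
    rw [hyc, mul_one]
  have h2 : u * c ∈ Submodule.span (MonoidAlgebra ℚ H) {u} := by
    refine Submodule.mem_span_singleton.2 ⟨1 - u * z, ?_⟩
    rw [smul_eq_mul, sub_mul, one_mul]
    exact sub_eq_of_eq_add' e.symm
  have h3 : u * c ∈ C := C.smul_mem u hc
  have h4 : u * c = 0 := by
    have := hC.disjoint.le_bot ⟨h2, h3⟩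
    simpa using this
  rw [h4, add_zero] at e
  exact e.symm

/-- Linear extension of a function on the group to the group algebra. -/
noncomputable def ext {H : Type*} {N : Type*} [AddCommGroup N] [Module ℚ N] (f : H → N) :
    MonoidAlgebra ℚ H →ₗ[ℚ] N where
  toFun x := Finsupp.linearCombination ℚ f x.coeff
  map_add' x y := by simp
  map_smul' r x := by simp

theorem ext_single {H : Type*} {N : Type*} [AddCommGroup N] [Module ℚ N] (f : H → N)
    (h : H) (r : ℚ) : ext f (single h r) = r • f h := by
  simp [ext]

/-- A two-sided ideal such that relations between `a - 1` and `b - 1` with coefficients in the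
ideal are annihilated by the ideal vanishes. -/
theorem ideal_zero {H : Type*} [Group H] [Finite H] (J : Submodule ℚ (MonoidAlgebra ℚ H))
    (hr : ∀ y ∈ J, ∀ c, y * c ∈ J) (a b : MonoidAlgebra ℚ H)
    (hJ : ∀ u ∈ J, ∀ v ∈ J, u * a + v * b = 0 → ∀ y ∈ J, y * u = 0 ∧ y * v = 0) :
    ∀ y ∈ J, y = 0 := by
  have hfin : FiniteDimensional ℚ (MonoidAlgebra ℚ H) :=
    inferInstance
  let f : (J × J) →ₗ[ℚ] J :=
    { toFun := fun p => ⟨p.1 * a + p.2 * b, J.add_mem (hr _ p.1.2 _) (hr _ p.2.2 _)⟩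
      map_add' := fun p p' => by ext1; simp [add_mul]; abel
      map_smul' := fun r p => by ext1; simp }
  have hf : Function.Injective f := by
    rw [← LinearMap.ker_eq_bot, LinearMap.ker_eq_bot']
    rintro ⟨⟨u, hu⟩, ⟨v, hv⟩⟩ h
    have h0 : u * a + v * b = 0 := congrArg Subtype.val h
    have hu0 : u = 0 := by
      obtain ⟨z, hz⟩ := regular u
      rw [hz]; exact (hJ u hu v hv h0 _ (hr u hu z)).1
    have hv0 : v = 0 := by
      obtain ⟨z, hz⟩ := regular v
      rw [hz]; exact (hJ u hu v hv h0 _ (hr v hv z)).2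
    subst hu0; subst hv0; rfl
  have h := LinearMap.finrank_le_finrank_of_injective hf
  rw [Module.finrank_prod] at h
  have h0 : Module.finrank ℚ J = 0 := by omega
  have := (Submodule.finrank_eq_zero (S := J)).1 h0
  intro y hy
  rw [this] at hy
  simpa using hy

section
variable {n : ℕ} {G : Type*} [Group G] (q : FreeGroup (Fin n) →* G)

/-- The affine action defining Fox derivatives. -/
noncomputable def perm : FreeGroup (Fin n) →* Equiv.Perm (Fin n → MonoidAlgebra ℚ G) :=
  FreeGroup.lift fun i =>
    { toFun := fun m => Pi.single i 1 + single (q (FreeGroup.of i)) (1 : ℚ) • m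
      invFun := fun m => single (q (FreeGroup.of i))⁻¹ (1 : ℚ) • (m - Pi.single i 1)
      left_inv := fun m => by
        dsimp only
        rw [add_sub_cancel_left, smul_smul, single_mul_single]; simp [← one_def]
      right_inv := fun m => by
        dsimp only
        rw [smul_smul, single_mul_single]; simp [← one_def] }

/-- The vector of Fox derivatives. -/
noncomputable def D (w : FreeGroup (Fin n)) : Fin n → MonoidAlgebra ℚ G := perm q w 0

theorem perm_apply (w : FreeGroup (Fin n)) (m : Fin n → MonoidAlgebra ℚ G) :
    perm q w m = D q w + single (q w) (1 : ℚ) • m := by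
  have key : ∀ u, (∀ m, perm q u m = D q u + single (q u) (1 : ℚ) • m) →
      ∀ m, perm q u⁻¹ m = D q u⁻¹ + single (q u⁻¹) (1 : ℚ) • m := by
    intro u hu m
    have h1 : ∀ m, perm q u⁻¹ m = single (q u)⁻¹ (1 : ℚ) • (m - D q u) := by
      intro m
      rw [map_inv, Equiv.Perm.inv_eq_iff_eq, hu, smul_smul, single_mul_single]
      simp [← one_def]
    rw [D, h1, h1, map_inv, ← smul_add]; congr 1; abel
  induction w using FreeGroup.induction_on generalizing m with
  | C1 => simp [D, ← one_def]
  | of i => simp [D, perm]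
  | inv_of i h => exact key _ h m
  | mul x y hx hy =>
    rw [D, map_mul, Equiv.Perm.mul_apply, Equiv.Perm.mul_apply, hx, hy, hx (perm q y 0), ← D,
      smul_add, smul_smul, single_mul_single, map_mul, one_mul, add_assoc]

theorem D_mul (x y : FreeGroup (Fin n)) : D q (x * y) = D q x + single (q x) (1 : ℚ) • D q y := by
  rw [← perm_apply, D, D, map_mul, Equiv.Perm.mul_apply]

theorem D_of (i : Fin n) : D q (FreeGroup.of i) = Pi.single i 1 := by
  simp [D, perm]

theorem D_one : D q 1 = 0 := by simp [D]

theorem D_inv (x : FreeGroup (Fin n)) :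
    D q x⁻¹ = - (single (q x)⁻¹ (1 : ℚ) • D q x) := by
  have h := D_mul q x⁻¹ x
  rw [inv_mul_cancel, D_one, map_inv] at h
  exact eq_neg_of_add_eq_zero_left h.symm

/-- Crossed homomorphisms agreeing on the generators are equal. -/
theorem cocycle_ext {E E' : FreeGroup (Fin n) → (Fin n → MonoidAlgebra ℚ G)}
    (h : ∀ x y, E (x * y) = E x + single (q x) (1 : ℚ) • E y)
    (h' : ∀ x y, E' (x * y) = E' x + single (q x) (1 : ℚ) • E' y)
    (hE : ∀ i, E (FreeGroup.of i) = E' (FreeGroup.of i)) (w) : E w = E' w := by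
  have one : ∀ (E : FreeGroup (Fin n) → (Fin n → MonoidAlgebra ℚ G)),
      (∀ x y, E (x * y) = E x + single (q x) (1 : ℚ) • E y) → E 1 = 0 := by
    intro E h
    have := h 1 1
    rw [map_one, ← one_def, one_smul, one_mul] at this
    simpa using this
  induction w using FreeGroup.induction_on with
  | C1 => rw [one E h, one E' h']
  | of i => exact hE i
  | inv_of i hi =>
    have e : ∀ (E : FreeGroup (Fin n) → (Fin n → MonoidAlgebra ℚ G)),
      (∀ x y, E (x * y) = E x + single (q x) (1 : ℚ) • E y) →
      E (FreeGroup.of i)⁻¹ = - (single (q (FreeGroup.of i)⁻¹) (1 : ℚ) • E (FreeGroup.of i)) := by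
      intro E h
      have h1 := h (FreeGroup.of i)⁻¹ (FreeGroup.of i)
      rw [inv_mul_cancel, one E h] at h1
      exact eq_neg_of_add_eq_zero_left h1.symm
    rw [e E h, e E' h', hi]
  | mul x y hx hy => rw [h, h', hx, hy]

theorem D_mul_ker {x : FreeGroup (Fin n)} (hx : q x = 1) (y) : D q (x * y) = D q x + D q y := by
  rw [D_mul, hx, ← one_def, one_smul]

theorem D_pow_ker {x : FreeGroup (Fin n)} (hx : q x = 1) (m : ℕ) :
    D q (x ^ m) = (m : ℚ) • D q x := by
  induction m with
  | zero => simp [D_one]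
  | succ m ih =>
    rw [pow_succ', D_mul_ker q hx, ih]; push_cast; rw [add_smul, one_smul, add_comm]

theorem D_conj (l : FreeGroup (Fin n)) {x : FreeGroup (Fin n)} (hx : q x = 1) :
    D q (l * x * l⁻¹) = single (q l) (1 : ℚ) • D q x := by
  rw [D_mul, D_mul, D_inv, map_mul, hx, mul_one, smul_neg, smul_smul, single_mul_single]
  simp [← one_def]

/-- The part of a group algebra element supported on the coset `g H`. -/
noncomputable def res (H : Subgroup G) (g : G) (β : MonoidAlgebra ℚ G) : MonoidAlgebra ℚ H :=
  ofCoeff (β.coeff.comapDomain (fun h : H => g * h) (fun a _ b _ h => by simpa using h))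

theorem res_apply (H : Subgroup G) (g : G) (β : MonoidAlgebra ℚ G) (h : H) :
    (res H g β).coeff h = β.coeff (g * h) := rfl

theorem res_mul (H : Subgroup G) (g : G) (β : MonoidAlgebra ℚ G) (c : MonoidAlgebra ℚ H) :
    res H g (β * mapDomainRingHom ℚ H.subtype c) = res H g β * c := by
  induction c using MonoidAlgebra.induction_linear with
  | zero => ext h; simp [res_apply]
  | add x y hx hy =>
    rw [map_add, mul_add, mul_add, ← hx, ← hy]; ext h; simp [res_apply]
  | single h r => ext k; simp [res_apply, mul_assoc]

/-- The annihilator statement: a group algebra element killing all classes of elements in the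
kernel of the rank two free factor vanishes. -/
theorem annihilator_zero [Finite G] (j k : Fin n) (hjk : j ≠ k) (β : MonoidAlgebra ℚ G)
    (hβ : ∀ x ∈ Subgroup.closure {FreeGroup.of j, FreeGroup.of k}, q x = 1 → β • D q x = 0) :
    β = 0 := by
  set L : Subgroup (FreeGroup (Fin n)) := Subgroup.closure {FreeGroup.of j, FreeGroup.of k} with hL
  have hjL : FreeGroup.of j ∈ L := Subgroup.subset_closure (by simp)
  have hkL : FreeGroup.of k ∈ L := Subgroup.subset_closure (by simp)
  let H : Subgroup G := L.map q
  let ι : MonoidAlgebra ℚ H →+* MonoidAlgebra ℚ G := mapDomainRingHom ℚ H.subtype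
  have ιs : ∀ (h : H) (r : ℚ), ι (single h r) = single (h : G) r := fun h r => by simp [ι]
  have ιsmul : ∀ (r : ℚ) (y), ι (r • y) = r • ι y := fun r y => by
    exact map_smul (mapDomainAlgHom ℚ ℚ H.subtype) r y
  have ιinj : Function.Injective ι := by
    intro x y h
    have e := congrArg (fun c => res H 1 (1 * c)) h
    simp only [ι, res_mul] at e
    have e1 : res H 1 (1 : MonoidAlgebra ℚ G) = 1 := by
      classical
      ext h
      rw [res_apply, one_def, one_def, coeff_single, coeff_single, Finsupp.single_apply,
        Finsupp.single_apply]
      congr 1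
      simp [eq_comm]
    simpa [e1] using e
  have hsec : ∀ h : H, ∃ l ∈ L, q l = h := fun h => h.2
  choose σ hσL hσ using hsec
  -- derivatives of elements of `L` are supported on `H`
  have hD : ∀ x ∈ L, ∀ i, ∃ c, D q x i = ι c := by
    intro x hx
    have hgen : ∀ t : Fin n, ∀ i, ∃ c, D q (FreeGroup.of t) i = ι c := by
      intro t i
      rw [D_of]
      by_cases h : i = t
      · subst h; exact ⟨1, by simp⟩
      · exact ⟨0, by simp [h]⟩
    induction hx using Subgroup.closure_induction with
    | mem x hx =>
      rcases hx with rfl | rfl <;> exact hgen _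
    | one => intro i; exact ⟨0, by simp [D_one]⟩
    | mul x y hx hy ihx ihy =>
      intro i
      obtain ⟨c, hc⟩ := ihx i
      obtain ⟨d, hd⟩ := ihy i
      refine ⟨c + single ⟨q x, x, hx, rfl⟩ 1 * d, ?_⟩
      rw [D_mul, map_add, map_mul, ιs, ← hc, ← hd]; rfl
    | inv x hx ih =>
      intro i
      obtain ⟨c, hc⟩ := ih i
      refine ⟨- (single (⟨q x, x, hx, rfl⟩⁻¹ : H) 1 * c), ?_⟩
      rw [D_inv, map_neg, map_mul, ιs, ← hc]; rfl
  let J : Submodule ℚ (MonoidAlgebra ℚ H) :=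
    { carrier := {y | ∀ x ∈ L, q x = 1 → ι y • D q x = 0}
      add_mem' := fun {y z} hy hz x hx hqx => by
        rw [map_add, add_smul, hy x hx hqx, hz x hx hqx, add_zero]
      zero_mem' := fun x hx hqx => by rw [map_zero, zero_smul]
      smul_mem' := fun r y hy x hx hqx => by
        rw [ιsmul, smul_assoc, hy x hx hqx, smul_zero] }
  have hr : ∀ y ∈ J, ∀ c, y * c ∈ J := by
    intro y hy c
    induction c using MonoidAlgebra.induction_linear with
    | zero => rw [mul_zero]; exact J.zero_mem
    | add a b ha hb => rw [mul_add]; exact J.add_mem ha hb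
    | single h r =>
      have : (single h r : MonoidAlgebra ℚ H) = r • single h 1 := by simp
      rw [this, mul_smul_comm]
      refine J.smul_mem r ?_
      intro x hx hqx
      rw [map_mul, ιs, mul_smul, ← hσ h, ← D_conj q (σ h) hqx]
      refine hy _ (L.mul_mem (L.mul_mem (hσL h) hx) (L.inv_mem (hσL h))) ?_
      simp [hqx]
  have hJ0 : ∀ y ∈ J, y = 0 := by
    refine ideal_zero J hr (single ⟨_, _, hjL, rfl⟩ 1 - 1) (single ⟨_, _, hkL, rfl⟩ 1 - 1) ?_
    intro u hu v hv huv y hy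
    let T : MonoidAlgebra ℚ H →ₗ[ℚ] (Fin n → MonoidAlgebra ℚ G) :=
      ext fun h => ι y • D q (σ h)
    have hT : ∀ (t : Fin n) (ht : FreeGroup.of t ∈ L) (u : MonoidAlgebra ℚ H),
        T (u * (single ⟨_, _, ht, rfl⟩ 1 - 1)) = Pi.single t (ι (y * u)) := by
      intro t ht u
      induction u using MonoidAlgebra.induction_linear with
      | zero => simp
      | add a b ha hb => rw [add_mul, map_add, ha, hb, mul_add, map_add, Pi.single_add]
      | single h r =>
        set a : H := ⟨_, _, ht, rfl⟩ with ha
        rw [mul_sub, single_mul_single, mul_one, mul_one, map_sub]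
        simp only [T]
        rw [ext_single, ext_single]
        have hx : ι y • D q (σ h * FreeGroup.of t * (σ (h * a))⁻¹) = 0 := by
          refine hy _ (L.mul_mem (L.mul_mem (hσL h) ht) (L.inv_mem (hσL _))) ?_
          rw [map_mul, map_mul, map_inv, hσ, hσ, Subgroup.coe_mul, mul_inv_eq_one]
        have hx1 : q (σ h * FreeGroup.of t * (σ (h * a))⁻¹) = 1 := by
          rw [map_mul, map_mul, map_inv, hσ, hσ, Subgroup.coe_mul, mul_inv_eq_one]
        have e := D_mul_ker q hx1 (σ (h * a))
        rw [inv_mul_cancel_right, D_mul, D_of, hσ] at e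
        have e2 := congrArg (fun m => ι y • m) e
        simp only [smul_add] at e2
        rw [hx, zero_add] at e2
        rw [← e2, ← smul_sub, add_sub_cancel_left, map_mul, ιs]
        have : (single (h : G) r : MonoidAlgebra ℚ G) = r • single (h : G) 1 := by simp
        rw [this, mul_smul_comm, Pi.single_smul, smul_smul]
        congr 1
        ext1 i
        by_cases hi : i = t
        · subst hi; simp
        · simp [hi]
    have h0 : Pi.single j (ι (y * u)) + Pi.single k (ι (y * v)) =
        (0 : Fin n → MonoidAlgebra ℚ G) := by
      rw [← hT j hjL, ← hT k hkL, ← map_add, huv, map_zero]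
    constructor
    · apply ιinj
      have := congrFun h0 j
      simpa [hjk] using this
    · apply ιinj
      have := congrFun h0 k
      simpa [hjk.symm] using this
  ext g
  have hg : res H g β ∈ J := by
    intro x hx hqx
    ext1 i
    obtain ⟨c, hc⟩ := hD x hx i
    have h1 := congrFun (hβ x hx hqx) i
    rw [Pi.smul_apply, smul_eq_mul, hc] at h1 ⊢
    rw [← map_mul, ← res_mul]
    change ι (res H g (β * ι c)) = 0
    rw [h1, Pi.zero_apply]
    have : res H g (0 : MonoidAlgebra ℚ G) = 0 := by ext; simp [res_apply]
    rw [this, map_zero]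
  have := res_apply H g β 1
  rw [hJ0 _ hg] at this
  simpa using this.symm

/-! ### The embedding of the homology into a free module -/

/-- The class of a kernel element. -/
noncomputable def cls (k : q.ker) : ℚ ⊗[ℤ] Additive (Abelianization q.ker) :=
  (1 : ℚ) ⊗ₜ[ℤ] Additive.ofMul (Abelianization.of k)

theorem cls_mul (k l : q.ker) : cls q (k * l) = cls q k + cls q l := by
  simp [cls, TensorProduct.tmul_add]

theorem cls_ext {N : Type*} [AddCommGroup N] [Module ℚ N]
    {f g : (ℚ ⊗[ℤ] Additive (Abelianization q.ker)) →ₗ[ℚ] N}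
    (h : ∀ k, f (cls q k) = g (cls q k)) (v) : f v = g v := by
  induction v using TensorProduct.induction_on with
  | zero => simp
  | add x y hx hy => rw [map_add, map_add, hx, hy]
  | tmul r y =>
    obtain ⟨k, hk⟩ := QuotientGroup.mk_surjective (Additive.toMul y)
    have : r ⊗ₜ[ℤ] y = r • cls q k := by
      rw [cls, TensorProduct.smul_tmul', smul_eq_mul, mul_one]
      congr 1
      exact congrArg Additive.ofMul hk.symm
    rw [this, map_smul, map_smul, h]

/-- Fox derivatives on the kernel as a homomorphism. -/
noncomputable def DK : q.ker →* Multiplicative (Fin n → MonoidAlgebra ℚ G) where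
  toFun k := Multiplicative.ofAdd (D q k)
  map_one' := by simp [D_one]
  map_mul' k l := by
    rw [Subgroup.coe_mul, D_mul_ker q k.2]; rfl

/-- Fox derivatives on rational homology. -/
noncomputable def dV :
    (ℚ ⊗[ℤ] Additive (Abelianization q.ker)) →ₗ[ℚ] (Fin n → MonoidAlgebra ℚ G) :=
  LinearMap.liftBaseChange ℚ
    (AddMonoidHom.toIntLinearMap (MonoidHom.toAdditiveLeft (Abelianization.lift (DK q))))

theorem dV_cls (k : q.ker) : dV q (cls q k) = D q k := by
  simp [dV, cls, DK]

theorem dV_injective (hq : Function.Surjective q) (v) (hv : dV q v = 0) : v = 0 := by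
  choose τ hτ using hq
  let σ : G → FreeGroup (Fin n) := fun g => (τ 1)⁻¹ * τ g
  have hσ : ∀ g, q (σ g) = g := fun g => by simp [σ, hτ]
  have hσ1 : σ 1 = 1 := by simp [σ]
  have hm : ∀ g w, σ g * w * (σ (g * q w))⁻¹ ∈ q.ker := fun g w => by
    rw [MonoidHom.mem_ker, map_mul, map_mul, map_inv, hσ, hσ, mul_inv_cancel]
  let S : (Fin n → MonoidAlgebra ℚ G) →ₗ[ℚ] (ℚ ⊗[ℤ] Additive (Abelianization q.ker)) :=
    ∑ i, (ext fun g => cls q ⟨_, hm g (FreeGroup.of i)⟩).comp (LinearMap.proj i)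
  have hS : ∀ w g, S (single g (1 : ℚ) • D q w) = cls q ⟨_, hm g w⟩ := by
    have cls1 : ∀ x (hx : x ∈ q.ker), x = 1 → cls q ⟨x, hx⟩ = 0 := by
      rintro x hx rfl
      have := cls_mul q 1 1
      rw [mul_one] at this
      have h0 : cls q 1 = 0 := by simpa using this
      exact h0
    have clsm : ∀ x y (hx : x ∈ q.ker) (hy : y ∈ q.ker) z (hz : z ∈ q.ker), z = x * y →
        cls q ⟨z, hz⟩ = cls q ⟨x, hx⟩ + cls q ⟨y, hy⟩ := by
      rintro x y hx hy z hz rfl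
      exact cls_mul q ⟨x, hx⟩ ⟨y, hy⟩
    have inv : ∀ u, (∀ g, S (single g (1 : ℚ) • D q u) = cls q ⟨_, hm g u⟩) →
        ∀ g, S (single g (1 : ℚ) • D q u⁻¹) = cls q ⟨_, hm g u⁻¹⟩ := by
      intro u hu g
      rw [D_inv, smul_neg, smul_smul, single_mul_single, one_mul, map_neg, hu]
      symm
      apply eq_neg_of_add_eq_zero_left
      rw [← clsm _ _ _ _ 1 (one_mem _), cls1 _ _ rfl]
      simp [mul_assoc]
    intro w
    induction w using FreeGroup.induction_on with
    | C1 => intro g; rw [D_one, smul_zero, map_zero, cls1]; simp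
    | of i =>
      intro g
      rw [D_of]
      simp only [S, LinearMap.sum_apply, LinearMap.comp_apply, LinearMap.proj_apply]
      rw [Finset.sum_eq_single i]
      · simp [ext_single]
      · intro b _ hb
        simp [hb]
      · simp
    | inv_of i h => exact inv _ h
    | mul x y hx hy =>
      intro g
      rw [D_mul, smul_add, smul_smul, single_mul_single, one_mul, map_add, hx, hy]
      symm
      apply clsm
      simp [mul_assoc]
  have h := cls_ext q (f := S.comp (dV q)) (g := LinearMap.id) (fun k => by
    have h1 := hS k 1
    rw [← one_def, one_smul] at h1
    rw [LinearMap.comp_apply, dV_cls, h1, LinearMap.id_apply]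
    congr 1
    ext1
    have hk : q (k : FreeGroup (Fin n)) = 1 := k.2
    simp [hσ1, hk]) v
  rw [LinearMap.comp_apply, hv, map_zero] at h
  exact h.symm

/-! ### Transvections -/

/-- The endomorphism sending the generator `i` to `x` times it and fixing the others. -/
def tv (i : Fin n) (x : FreeGroup (Fin n)) : FreeGroup (Fin n) →* FreeGroup (Fin n) :=
  FreeGroup.lift fun t => if t = i then x * FreeGroup.of i else FreeGroup.of t

theorem tv_fix {i j k : Fin n} (hj : j ≠ i) (hk : k ≠ i) (y : FreeGroup (Fin n))
    {x} (hx : x ∈ Subgroup.closure {FreeGroup.of j, FreeGroup.of k}) : tv i y x = x := by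
  have : Set.EqOn (tv i y) (MonoidHom.id _) {FreeGroup.of j, FreeGroup.of k} := by
    rintro z (rfl | rfl) <;> simp [tv, hj, hk]
  exact MonoidHom.eqOn_closure this hx

theorem tv_inv {i j k : Fin n} (hj : j ≠ i) (hk : k ≠ i)
    {x} (hx : x ∈ Subgroup.closure {FreeGroup.of j, FreeGroup.of k}) :
    (tv i x⁻¹).comp (tv i x) = MonoidHom.id _ := by
  apply FreeGroup.ext_hom
  intro t
  have hf := tv_fix hj hk x⁻¹ hx
  by_cases h : t = i
  · subst h
    have e1 : tv t x (FreeGroup.of t) = x * FreeGroup.of t := by simp [tv]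
    have e2 : tv t x⁻¹ (FreeGroup.of t) = x⁻¹ * FreeGroup.of t := by simp [tv]
    rw [MonoidHom.comp_apply, e1, map_mul, hf, e2]; simp
  · simp [tv, h]

/-- Transvections as automorphisms. -/
def tvE {i j k : Fin n} (hj : j ≠ i) (hk : k ≠ i)
    {x} (hx : x ∈ Subgroup.closure {FreeGroup.of j, FreeGroup.of k}) :
    FreeGroup (Fin n) ≃* FreeGroup (Fin n) :=
  MonoidHom.toMulEquiv (tv i x) (tv i x⁻¹) (tv_inv hj hk hx) (by
    have := tv_inv hj hk (inv_mem hx)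
    rwa [inv_inv] at this)

theorem q_tv (i : Fin n) {x} (hx : q x = 1) : q.comp (tv i x) = q := by
  apply FreeGroup.ext_hom
  intro t
  by_cases h : t = i
  · subst h; simp [tv, hx]
  · simp [tv, h]

theorem D_tv (i : Fin n) {x} (hx : q x = 1) (w) :
    D q (tv i x w) = D q w + D q w i • D q x := by
  refine cocycle_ext q (E := fun w => D q (tv i x w)) (E' := fun w => D q w + D q w i • D q x)
    ?_ ?_ ?_ w
  · intro u v
    have : q (tv i x u) = q u := DFunLike.congr_fun (q_tv q i hx) u
    rw [map_mul, D_mul, this]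
  · intro u v
    rw [D_mul, Pi.add_apply, add_smul, Pi.smul_apply, smul_assoc, smul_add]
    abel
  · intro t
    by_cases h : t = i
    · subst h
      simp only [tv, FreeGroup.lift_apply_of, if_true]
      rw [D_mul_ker q hx, D_of]
      simp [add_comm]
    · simp [tv, h, D_of, Ne.symm h]

theorem dV_induced (i : Fin n) {x} (hx : q x = 1) (φ : FreeGroup (Fin n) ≃* FreeGroup (Fin n))
    (hφ : q.comp φ.toMonoidHom = q) (h : ∀ w, φ w = tv i x w) (v) :
    dV q (inducedAuto q φ hφ v) = dV q v + dV q v i • D q x := by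
  let R : (ℚ ⊗[ℤ] Additive (Abelianization q.ker)) →ₗ[ℚ] (Fin n → MonoidAlgebra ℚ G) :=
    { toFun := fun v => dV q v + dV q v i • D q x
      map_add' := fun a b => by rw [map_add, Pi.add_apply, add_smul]; abel
      map_smul' := fun r a => by
        rw [map_smul, Pi.smul_apply, smul_assoc, RingHom.id_apply, smul_add] }
  refine cls_ext q (f := (dV q).comp (inducedAuto q φ hφ).toLinearMap) (g := R) (fun k => ?_) v
  have e : inducedAuto q φ hφ (cls q k) = cls q (kerRestrict q φ hφ k) := by
    simp [inducedAuto, cls]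
  have e2 : ((kerRestrict q φ hφ k : q.ker) : FreeGroup (Fin n)) = tv i x k := h k
  change dV q (inducedAuto q φ hφ (cls q k)) = dV q (cls q k) + dV q (cls q k) i • D q x
  rw [e, dV_cls, dV_cls, e2, D_tv q i hx]

end

end Fox

/-- **Moving homology classes in covers** (Theorem 1.1, orbit form).
If `n ≥ 3` and `q : Fₙ → G` is a surjection onto a finite group with kernel `K`, then the
orbit `{φ̃ v : φ ∈ Aut(Fₙ), q ∘ φ = q}` of any nonzero `v ∈ V = ℚ ⊗ (K)ᵃᵇ` is infinite. -/
theorem orbit_infinite (n : ℕ) (hn : 3 ≤ n)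
    (G : Type) [Group G] [Finite G]
    (q : FreeGroup (Fin n) →* G) (hq : Function.Surjective q)
    (v : ℚ ⊗[ℤ] Additive (Abelianization q.ker)) (hv : v ≠ 0) :
    {w : ℚ ⊗[ℤ] Additive (Abelianization q.ker) |
      ∃ (φ : FreeGroup (Fin n) ≃* FreeGroup (Fin n)) (hφ : q.comp φ.toMonoidHom = q),
        (inducedAuto q φ hφ) v = w}.Infinite := by
  intro hfin
  apply hv
  apply Fox.dV_injective q hq
  ext1 i
  have hjk : ∃ j k : Fin n, j ≠ i ∧ k ≠ i ∧ j ≠ k := by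
    have hc : 2 ≤ ((Finset.univ : Finset (Fin n)).erase i).card := by
      rw [Finset.card_erase_of_mem (Finset.mem_univ i), Finset.card_univ, Fintype.card_fin]
      omega
    obtain ⟨j, hj, k, hk, hne⟩ := Finset.one_lt_card.1 hc
    exact ⟨j, k, Finset.ne_of_mem_erase hj, Finset.ne_of_mem_erase hk, hne⟩
  obtain ⟨j, k, hj, hk, hne⟩ := hjk
  refine Fox.annihilator_zero q j k hne _ ?_
  intro x hx hqx
  by_contra hne0
  have hqm : ∀ m : ℕ, q (x ^ m) = 1 := fun m => by rw [map_pow, hqx, one_pow]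
  let φ : ℕ → (FreeGroup (Fin n) ≃* FreeGroup (Fin n)) := fun m =>
    Fox.tvE hj hk (pow_mem hx m)
  have hφ : ∀ m, q.comp (φ m).toMonoidHom = q := fun m => Fox.q_tv q i (hqm m)
  have hmem : ∀ m : ℕ, inducedAuto q (φ m) (hφ m) v ∈
      {w : ℚ ⊗[ℤ] Additive (Abelianization q.ker) |
      ∃ (φ : FreeGroup (Fin n) ≃* FreeGroup (Fin n)) (hφ : q.comp φ.toMonoidHom = q),
        (inducedAuto q φ hφ) v = w} := fun m => ⟨φ m, hφ m, rfl⟩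
  refine Set.infinite_of_injective_forall_mem
    (f := fun m : ℕ => inducedAuto q (φ m) (hφ m) v) ?_ hmem hfin
  intro m m' h
  have h1 := congrArg (Fox.dV q) h
  simp only at h1
  rw [Fox.dV_induced q i (hqm m) (φ m) (hφ m) (fun _ => rfl),
    Fox.dV_induced q i (hqm m') (φ m') (hφ m') (fun _ => rfl), add_right_inj,
    Fox.D_pow_ker q hqx, Fox.D_pow_ker q hqx, smul_comm, smul_comm _ (m' : ℚ)] at h1
  exact_mod_cast smul_left_injective ℚ hne0 h1
end

section
/- (Chevalley–Weil for graphs.) Suppose n ≥ 2. There exists a representation ρ : G →* (V ≃ₗ[ℚ] V) such that ρ(q(w)) [k] = [w k w⁻¹] for every w ∈ Fₙ and k ∈ K, and such that V, regarded as a module over the group algebra MonoidAlgebra ℚ G via ρ, is isomorphic as a MonoidAlgebra ℚ G-module to (Fin (n−1) → MonoidAlgebra ℚ G) × ℚ, i.e. to the direct sum of n−1 copies of the regular representation ℚ[G] and one copy of the trivial representation ℚ. -/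
open TensorProduct

/-- The homology class of an element `k` of the kernel, in `V = ℚ ⊗[ℤ] (ker q)ᵃᵇ`. -/
noncomputable def cls {n : ℕ} {G : Type*} [Group G] (q : FreeGroup (Fin n) →* G)
    (k : q.ker) : ℚ ⊗[ℤ] Additive (Abelianization q.ker) :=
  (1 : ℚ) ⊗ₜ[ℤ] Additive.ofMul (Abelianization.of k)

/-- The representation (in the sense of `Representation`) associated to a homomorphism
into the group of `ℚ`-linear automorphisms. -/
def repOfAut {G V : Type*} [Group G] [AddCommGroup V] [Module ℚ V]
    (ρ : G →* (V ≃ₗ[ℚ] V)) : Representation ℚ G V where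
  toFun g := (ρ g).toLinearMap
  map_one' := by ext v; simp
  map_mul' g h := by ext v; simp


theorem cw_split {R M N : Type*} [Ring R] [AddCommGroup M] [Module R M] [AddCommGroup N] [Module R N]
    [IsSemisimpleModule R M] (f : M →ₗ[R] N) (hf : Function.Surjective f) :
    Nonempty (M ≃ₗ[R] (LinearMap.ker f × N)) := by
  obtain ⟨C, hC⟩ := exists_isCompl (LinearMap.ker f)
  exact ⟨(Submodule.prodEquivOfIsCompl _ _ hC).symm.trans
    ((LinearEquiv.refl R _).prodCongr
      ((Submodule.quotientEquivOfIsCompl _ _ hC).symm.trans (f.quotKerEquivOfSurjective hf)))⟩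

theorem cw_quot_equiv_prod {R P : Type*} [Ring R] [AddCommGroup P] [Module R P]
    (S T C : Submodule R P) (h : Disjoint S T) (hC : IsCompl (S ⊔ T) C) :
    Nonempty ((P ⧸ S) ≃ₗ[R] (T × C)) := by
  have hTC : Disjoint T C := hC.disjoint.mono_left le_sup_right
  have h1 : IsCompl S (T ⊔ C) := by
    constructor
    · exact Disjoint.disjoint_sup_right_of_disjoint_sup_left h hC.disjoint
    · rw [codisjoint_iff, ← sup_assoc]; exact hC.sup_eq_top
  let g : (T × C) →ₗ[R] P := T.subtype.coprod C.subtype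
  have hg : Function.Injective g := by
    rw [← LinearMap.ker_eq_bot]
    rw [LinearMap.ker_coprod_of_disjoint_range]
    · simp
    · simpa using hTC
  have hr : LinearMap.range g = T ⊔ C := by simp [g, LinearMap.range_coprod]
  exact ⟨(Submodule.quotientEquivOfIsCompl _ _ h1).trans
    ((LinearEquiv.ofEq _ _ hr.symm).trans (LinearEquiv.ofInjective g hg).symm)⟩

theorem cw_simple_cancel {R M N S : Type*} [Ring R] [IsSemisimpleRing R]
    [AddCommGroup M] [Module R M] [AddCommGroup N] [Module R N] [AddCommGroup S] [Module R S]
    [IsSimpleModule R S] (e : (M × S) ≃ₗ[R] (N × S)) : Nonempty (M ≃ₗ[R] N) := by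
  let f1 : (M × S) →ₗ[R] M := LinearMap.fst R M S
  let f2 : (M × S) →ₗ[R] N := LinearMap.fst R N S ∘ₗ e.toLinearMap
  have hf1 : Function.Surjective f1 := Prod.fst_surjective
  have hf2 : Function.Surjective f2 := Prod.fst_surjective.comp e.surjective
  let i1 : S →ₗ[R] (M × S) := LinearMap.inr R M S
  let i2 : S →ₗ[R] (M × S) := e.symm.toLinearMap ∘ₗ LinearMap.inr R N S
  have hi1 : Function.Injective i1 := LinearMap.inr_injective
  have hi2 : Function.Injective i2 := e.symm.injective.comp LinearMap.inr_injective
  have k1 : LinearMap.range i1 = LinearMap.ker f1 := by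
    simp [i1, f1, LinearMap.range_inr]
  have k2 : LinearMap.range i2 = LinearMap.ker f2 := by
    ext x
    simp only [LinearMap.mem_range, LinearMap.mem_ker, i2, f2, LinearMap.comp_apply,
      LinearEquiv.coe_coe, LinearMap.inr_apply, LinearMap.fst_apply]
    constructor
    · rintro ⟨y, rfl⟩; simp
    · intro h; exact ⟨(e x).2, by rw [LinearEquiv.symm_apply_eq]; ext <;> simp [h]⟩
  let e1 := LinearEquiv.ofInjective i1 hi1
  let e2 := LinearEquiv.ofInjective i2 hi2
  have s1 : IsSimpleModule R (LinearMap.range i1) := IsSimpleModule.congr e1.symm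
  have s2 : IsSimpleModule R (LinearMap.range i2) := IsSimpleModule.congr e2.symm
  have q1 : ((M × S) ⧸ LinearMap.range i1) ≃ₗ[R] M :=
    (Submodule.quotEquivOfEq _ _ k1).trans (f1.quotKerEquivOfSurjective hf1)
  have q2 : ((M × S) ⧸ LinearMap.range i2) ≃ₗ[R] N :=
    (Submodule.quotEquivOfEq _ _ k2).trans (f2.quotKerEquivOfSurjective hf2)
  by_cases h : LinearMap.range i1 = LinearMap.range i2
  · exact ⟨q1.symm.trans ((Submodule.quotEquivOfEq _ _ h).trans q2)⟩
  · rw [isSimpleModule_iff_isAtom] at s1 s2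
    have hd := s1.disjoint_of_ne s2 h
    obtain ⟨C, hC⟩ := exists_isCompl (LinearMap.range i1 ⊔ LinearMap.range i2)
    obtain ⟨a⟩ := cw_quot_equiv_prod _ _ C hd hC
    obtain ⟨b⟩ := cw_quot_equiv_prod _ _ C hd.symm (by rwa [sup_comm])
    exact ⟨q1.symm.trans (a.trans (((e2.symm.trans e1).prodCongr (LinearEquiv.refl R C)).trans
      (b.symm.trans q2)))⟩

theorem cw_cancel {R : Type*} [Ring R] [IsSemisimpleRing R] {I : Type}
    [AddCommGroup I] [Module R I] (hI : IsFiniteLength R I) :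
    ∀ {M N : Type} [AddCommGroup M] [Module R M] [AddCommGroup N] [Module R N]
      (_ : (M × I) ≃ₗ[R] (N × I)), Nonempty (M ≃ₗ[R] N) := by
  induction hI with
  | @of_subsingleton I _ _ _ =>
    intro M N _ _ _ _ e
    let _ : Unique I := uniqueOfSubsingleton 0
    exact ⟨LinearEquiv.prodUnique.symm.trans (e.trans LinearEquiv.prodUnique)⟩
  | @of_simple_quotient I _ _ J _ _ ih =>
    intro M N _ _ _ _ e
    obtain ⟨t⟩ := cw_split J.mkQ J.mkQ_surjective
    have t' : I ≃ₗ[R] ((I ⧸ J) × J) := (t.trans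
      ((LinearEquiv.ofEq _ _ J.ker_mkQ).prodCongr (LinearEquiv.refl R _))).trans
      (LinearEquiv.prodComm R _ _)
    have u : ∀ (X : Type) [AddCommGroup X] [Module R X],
        Nonempty ((X × I) ≃ₗ[R] ((X × (I ⧸ J)) × J)) := fun X _ _ =>
      ⟨((LinearEquiv.refl R X).prodCongr t').trans (LinearEquiv.prodAssoc R X _ _).symm⟩
    obtain ⟨u1⟩ := u M
    obtain ⟨u2⟩ := u N
    obtain ⟨v⟩ := ih (u1.symm.trans (e.trans u2))
    exact cw_simple_cancel v


section
variable {n : ℕ} {G : Type} [Group G] (q : FreeGroup (Fin n) →* G)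

/-- group elements in the group algebra -/
noncomputable abbrev cwOf (g : G) : MonoidAlgebra ℚ G := MonoidAlgebra.single g 1

theorem cwOf_mul (g h : G) : cwOf (g * h) = cwOf g * cwOf h := by
  simp [cwOf, MonoidAlgebra.single_mul_single]

theorem cwOf_one : cwOf (1 : G) = 1 := rfl

/-- The affine permutation attached to a generator. -/
noncomputable def cwAff (i : Fin n) : Equiv.Perm (Fin n → MonoidAlgebra ℚ G) where
  toFun m := Pi.single i 1 + cwOf (q (FreeGroup.of i)) • m
  invFun m := cwOf (q (FreeGroup.of i))⁻¹ • (m - Pi.single i 1)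
  left_inv m := by
    simp only [add_sub_cancel_left, smul_smul, ← cwOf_mul, inv_mul_cancel, cwOf_one, one_smul]
  right_inv m := by
    simp only [smul_smul, ← cwOf_mul, mul_inv_cancel, cwOf_one, one_smul]; abel

/-- The Fox derivative. -/
noncomputable def cwD (w : FreeGroup (Fin n)) : Fin n → MonoidAlgebra ℚ G :=
  FreeGroup.lift (cwAff q) w 0

theorem cwD_aff (w : FreeGroup (Fin n)) : ∀ m,
    FreeGroup.lift (cwAff q) w m = cwD q w + cwOf (q w) • m := by
  induction w using FreeGroup.induction_on with
  | C1 => intro m; simp [cwD, cwOf_one]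
  | of i => intro m; simp [cwD, cwAff]
  | inv_of i _ =>
    intro m
    simp only [cwD, map_inv, FreeGroup.lift_apply_of]
    change cwOf (q (FreeGroup.of i))⁻¹ • (m - Pi.single i 1) =
      cwOf (q (FreeGroup.of i))⁻¹ • (0 - Pi.single i 1) + _
    rw [smul_sub, smul_sub, smul_zero]; abel
  | mul u v hu hv =>
    intro m
    have : cwD q (u * v) = cwD q u + cwOf (q u) • cwD q v := by
      rw [cwD, map_mul, Equiv.Perm.mul_apply, hu]; rfl
    rw [map_mul, Equiv.Perm.mul_apply, hv, hu, this, map_mul, cwOf_mul, mul_smul, smul_add,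
      add_assoc]

theorem cwD_mul (u v : FreeGroup (Fin n)) : cwD q (u * v) = cwD q u + cwOf (q u) • cwD q v := by
  rw [cwD, map_mul, Equiv.Perm.mul_apply, cwD_aff]; rfl

theorem cwD_one : cwD q 1 = 0 := by simp [cwD]

theorem cwD_of (i : Fin n) : cwD q (FreeGroup.of i) = Pi.single i 1 := by simp [cwD, cwAff]

theorem cwD_inv (u : FreeGroup (Fin n)) : cwD q u⁻¹ = - (cwOf (q u)⁻¹ • cwD q u) := by
  have h := cwD_mul q u⁻¹ u
  rw [inv_mul_cancel, cwD_one, map_inv] at h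
  exact eq_neg_of_add_eq_zero_left h.symm

theorem cwD_mul_inv (u v : FreeGroup (Fin n)) (h : q u = q v) :
    cwD q (u * v⁻¹) = cwD q u - cwD q v := by
  rw [cwD_mul, cwD_inv, h, smul_neg, smul_smul, ← cwOf_mul, mul_inv_cancel, cwOf_one, one_smul,
    sub_eq_add_neg]

theorem cwD_conj (w k : FreeGroup (Fin n)) (hk : q k = 1) :
    cwD q (w * k * w⁻¹) = cwOf (q w) • cwD q k := by
  rw [cwD_mul_inv q _ _ (by simp [hk]), cwD_mul]; abel

/-- Boundary map. -/
noncomputable def cwBd : (Fin n → MonoidAlgebra ℚ G) →ₗ[MonoidAlgebra ℚ G] MonoidAlgebra ℚ G :=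
  Fintype.linearCombination (MonoidAlgebra ℚ G) (fun i => cwOf (q (FreeGroup.of i)) - 1)

theorem cwBd_D (w : FreeGroup (Fin n)) : cwBd q (cwD q w) = cwOf (q w) - 1 := by
  induction w using FreeGroup.induction_on with
  | C1 => simp [cwD_one, cwOf_one]
  | of i => rw [cwD_of]; simp [cwBd, Fintype.linearCombination_apply_single]
  | inv_of i h =>
    rw [cwD_inv, map_neg, map_smul, h, map_inv, smul_eq_mul, mul_sub, ← cwOf_mul,
      inv_mul_cancel, cwOf_one]; simp
  | mul u v hu hv =>
    rw [cwD_mul, map_add, map_smul, hu, hv, map_mul, cwOf_mul, smul_eq_mul, mul_sub]; simp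

theorem cls_mul (k l : q.ker) : cls q (k * l) = cls q k + cls q l := by
  simp [cls, TensorProduct.tmul_add]

theorem cls_ext {W : Type*} [AddCommGroup W] [Module ℚ W]
    {f g : (ℚ ⊗[ℤ] Additive (Abelianization q.ker)) →ₗ[ℚ] W}
    (h : ∀ k, f (cls q k) = g (cls q k)) : f = g := by
  apply TensorProduct.AlgebraTensorModule.ext
  intro r x
  obtain ⟨x, rfl⟩ := Additive.ofMul.surjective x
  obtain ⟨k, rfl⟩ : ∃ k, Abelianization.of k = x := QuotientGroup.mk_surjective x
  have : r ⊗ₜ[ℤ] Additive.ofMul (Abelianization.of k) = r • cls q k := by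
    simp only [cls, TensorProduct.smul_tmul', smul_eq_mul, mul_one]
  rw [this, map_smul, map_smul, h]

/-- The map on homology induced by the Fox derivative. -/
noncomputable def cwV : (ℚ ⊗[ℤ] Additive (Abelianization q.ker)) →ₗ[ℚ]
    (Fin n → MonoidAlgebra ℚ G) :=
  LinearMap.liftBaseChange ℚ (AddMonoidHom.toIntLinearMap
    (MonoidHom.toAdditiveLeft (Abelianization.lift
      ({ toFun := fun k => Multiplicative.ofAdd (cwD q k)
         map_one' := by simp [cwD_one]
         map_mul' := fun k l => by
          have : q (k : FreeGroup (Fin n)) = 1 := k.2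
          rw [Subgroup.coe_mul, cwD_mul, this, cwOf_one, one_smul, ofAdd_add] } :
        q.ker →* Multiplicative (Fin n → MonoidAlgebra ℚ G)))))

theorem cwV_cls (k : q.ker) : cwV q (cls q k) = cwD q k := by
  simp [cwV, cls]

/-- Schreier class -/
noncomputable def cwC (s : G → FreeGroup (Fin n)) (hs : ∀ g, q (s g) = g) (g : G)
    (w : FreeGroup (Fin n)) : ℚ ⊗[ℤ] Additive (Abelianization q.ker) :=
  cls q ⟨s g * w * (s (g * q w))⁻¹, by simp [MonoidHom.mem_ker, hs]⟩

theorem cwC_mul (s : G → FreeGroup (Fin n)) (hs : ∀ g, q (s g) = g) (g : G)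
    (u v : FreeGroup (Fin n)) :
    cwC q s hs g (u * v) = cwC q s hs g u + cwC q s hs (g * q u) v := by
  rw [cwC, cwC, cwC, ← cls_mul]
  congr 1
  ext
  simp [mul_assoc]

/-- Inverse map -/
noncomputable def cwPhi (s : G → FreeGroup (Fin n)) (hs : ∀ g, q (s g) = g) :
    (Fin n → MonoidAlgebra ℚ G) →ₗ[ℚ] ℚ ⊗[ℤ] Additive (Abelianization q.ker) :=
  LinearMap.lsum ℚ (fun _ => MonoidAlgebra ℚ G) ℚ
    (fun i => (MonoidAlgebra.basis G ℚ).constr ℚ (fun g => cwC q s hs g (FreeGroup.of i)))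

theorem cwPhi_single (s : G → FreeGroup (Fin n)) (hs : ∀ g, q (s g) = g) (i : Fin n) (g : G) :
    cwPhi q s hs (Pi.single i (cwOf g)) = cwC q s hs g (FreeGroup.of i) := by
  rw [cwPhi, LinearMap.lsum_piSingle, cwOf, ← MonoidAlgebra.basis_apply, Module.Basis.constr_basis]

theorem cw_ext {W : Type*} [AddCommGroup W] [Module ℚ W]
    {f g : (Fin n → MonoidAlgebra ℚ G) →ₗ[ℚ] W}
    (h : ∀ i x, f (Pi.single i (cwOf x)) = g (Pi.single i (cwOf x))) : f = g := by
  apply LinearMap.pi_ext'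
  intro i
  apply (MonoidAlgebra.basis G ℚ).ext
  intro x
  simpa using h i x

theorem cwPhi_D (s : G → FreeGroup (Fin n)) (hs : ∀ g, q (s g) = g) (w : FreeGroup (Fin n)) :
    ∀ g, cwPhi q s hs (cwOf g • cwD q w) = cwC q s hs g w := by
  have hC1 : ∀ g, cwC q s hs g 1 = 0 := fun g => by
    have := cwC_mul q s hs g 1 1
    simpa using this
  induction w using FreeGroup.induction_on with
  | C1 => intro g; simp [cwD_one, hC1]
  | of i => 
    intro g
    rw [cwD_of, ← cwPhi_single, ← Pi.single_smul, smul_eq_mul, mul_one]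
  | inv_of i h =>
    intro g
    have := cwC_mul q s hs g (FreeGroup.of i)⁻¹ (FreeGroup.of i)
    rw [inv_mul_cancel, hC1] at this
    rw [cwD_inv, smul_neg, smul_smul, ← cwOf_mul, map_neg, h, map_inv] at *
    exact (eq_neg_of_add_eq_zero_left this.symm).symm
  | mul u v hu hv =>
    intro g
    rw [cwD_mul, smul_add, smul_smul, ← cwOf_mul, map_add, hu, hv, cwC_mul]

theorem cwPhi_V (s : G → FreeGroup (Fin n)) (hs : ∀ g, q (s g) = g) (h1 : s 1 = 1) (v) :
    cwPhi q s hs (cwV q v) = v := by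
  have : cwPhi q s hs ∘ₗ cwV q = LinearMap.id := by
    apply cls_ext
    intro k
    have hk : q (k : FreeGroup (Fin n)) = 1 := k.2
    have := cwPhi_D q s hs k 1
    rw [cwOf_one, one_smul] at this
    rw [LinearMap.comp_apply, cwV_cls, this, cwC, LinearMap.id_apply]
    congr 1
    ext
    simp [hk, h1]
  exact LinearMap.congr_fun this v

/-- The section as a linear map -/
noncomputable def cwS (s : G → FreeGroup (Fin n)) :
    MonoidAlgebra ℚ G →ₗ[ℚ] (Fin n → MonoidAlgebra ℚ G) :=
  (MonoidAlgebra.basis G ℚ).constr ℚ (fun g => cwD q (s g))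

theorem cwS_of (s : G → FreeGroup (Fin n)) (g : G) : cwS q s (cwOf g) = cwD q (s g) := by
  rw [cwS, cwOf, ← MonoidAlgebra.basis_apply, Module.Basis.constr_basis]

theorem cwV_Phi (s : G → FreeGroup (Fin n)) (hs : ∀ g, q (s g) = g) (m) :
    cwV q (cwPhi q s hs m) = m - cwS q s (cwBd q m) := by
  have : cwV q ∘ₗ cwPhi q s hs = LinearMap.id - cwS q s ∘ₗ (cwBd q).restrictScalars ℚ := by
    apply cw_ext
    intro i g
    have hb : cwBd q (Pi.single i (cwOf g)) = cwOf (g * q (FreeGroup.of i)) - cwOf g := by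
      rw [cwBd, Fintype.linearCombination_apply_single, smul_eq_mul, mul_sub, cwOf_mul, mul_one]
    simp only [LinearMap.comp_apply, LinearMap.sub_apply, LinearMap.id_apply,
      LinearMap.restrictScalars_apply]
    rw [hb, map_sub, cwS_of, cwS_of, cwPhi_single, cwC, cwV_cls, cwD_mul_inv _ _ _ (by simp [hs]),
      cwD_mul, hs, cwD_of, ← Pi.single_smul, smul_eq_mul, mul_one]
    abel
  exact LinearMap.congr_fun this m

theorem cwBd_V (v) : cwBd q (cwV q v) = 0 := by
  have : (cwBd q).restrictScalars ℚ ∘ₗ cwV q = 0 := by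
    apply cls_ext
    intro k
    have hk : q (k : FreeGroup (Fin n)) = 1 := k.2
    simp [cwV_cls, cwBd_D, hk, cwOf_one]
  exact LinearMap.congr_fun this v

theorem cw_exists_equiv (hq : Function.Surjective q) :
    ∃ e : (ℚ ⊗[ℤ] Additive (Abelianization q.ker)) ≃ₗ[ℚ] LinearMap.ker (cwBd q),
      ∀ k, (e (cls q k) : Fin n → MonoidAlgebra ℚ G) = cwD q k := by
  classical
  obtain ⟨s0, hs0⟩ := hq.hasRightInverse
  let s : G → FreeGroup (Fin n) := Function.update s0 1 1
  have h1 : s 1 = 1 := by simp [s]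
  have hs : ∀ g, q (s g) = g := by
    intro g
    by_cases h : g = 1
    · subst h; simp [h1]
    · simp [s, h, hs0 g]
  let f : (ℚ ⊗[ℤ] Additive (Abelianization q.ker)) →ₗ[ℚ] LinearMap.ker (cwBd q) :=
    { toFun := fun v => ⟨cwV q v, cwBd_V q v⟩
      map_add' := fun a b => by ext1; simp
      map_smul' := fun a b => by ext1; simp }
  refine ⟨LinearEquiv.ofBijective f ⟨fun a b h => ?_, fun m => ⟨cwPhi q s hs m, ?_⟩⟩, ?_⟩
  · have : cwV q a = cwV q b := congrArg Subtype.val h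
    rw [← cwPhi_V q s hs h1 a, this, cwPhi_V]
    exact h1
  · have hm : cwBd q m = 0 := m.2
    ext1
    change cwV q _ = _
    rw [cwV_Phi, hm, map_zero, sub_zero]
  · intro k
    exact cwV_cls q k

/-- Augmentation. -/
noncomputable def cwAug (G : Type) [Group G] : MonoidAlgebra ℚ G →ₗ[MonoidAlgebra ℚ G]
    (Representation.trivial ℚ (G := G) (V := ℚ)).asModule :=
  LinearMap.toSpanSingleton _ _
    ((Representation.trivial ℚ (G := G) (V := ℚ)).asModuleEquiv.symm 1)

theorem cwAug_of (g : G) : cwAug G (cwOf g) =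
    (Representation.trivial ℚ (G := G) (V := ℚ)).asModuleEquiv.symm 1 := by
  rw [cwAug, LinearMap.toSpanSingleton_apply]
  have := Representation.asModuleEquiv_symm_map_rho
    (Representation.trivial ℚ (G := G) (V := ℚ)) g 1
  exact this.symm

theorem cwAug_surj : Function.Surjective (cwAug G) := by
  intro y
  refine ⟨(Representation.trivial ℚ (G := G) (V := ℚ)).asModuleEquiv y • cwOf 1, ?_⟩
  rw [LinearMap.map_smul_of_tower, cwAug_of, ← map_smul, smul_eq_mul, mul_one,
    LinearEquiv.symm_apply_apply]

theorem cw_ker_aug (hq : Function.Surjective q) :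
    LinearMap.ker (cwAug G) = LinearMap.range (cwBd q) := by
  apply le_antisymm
  · intro a ha
    obtain ⟨s, hs⟩ := hq.hasRightInverse
    have key : (cwBd q).restrictScalars ℚ ∘ₗ cwS q s = LinearMap.id -
        (LinearMap.toSpanSingleton ℚ (MonoidAlgebra ℚ G) 1) ∘ₗ
          (Representation.trivial ℚ (G := G) (V := ℚ)).asModuleEquiv.toLinearMap ∘ₗ
          (cwAug G).restrictScalars ℚ := by
      apply (MonoidAlgebra.basis G ℚ).ext
      intro g
      have h2 := cwAug_of g
      have h3 := cwS_of q s g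
      simp only [cwOf] at h2 h3
      simp [h2, h3, cwBd_D, hs g]
    have := LinearMap.congr_fun key a
    rw [LinearMap.mem_ker] at ha
    simp [ha] at this
    exact ⟨_, this⟩
  · rintro _ ⟨m, rfl⟩
    have : cwAug G ∘ₗ cwBd q = 0 := by
      apply LinearMap.pi_ext'
      intro i
      apply LinearMap.ext_ring
      simp [cwBd, Fintype.linearCombination_apply_single]
      rw [cwAug_of, ← cwOf_one, cwAug_of, sub_self]
    exact LinearMap.congr_fun this m

end

/-- **Chevalley–Weil for graphs** (Theorem 1.2). For `n ≥ 2` and a surjection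
`q : Fₙ → G` onto a finite group `G` with kernel `K`, conjugation induces a `G`-action on
`V = ℚ ⊗ Kᵃᵇ` (the rational first homology of the cover), and as a module over the group
algebra `ℚ[G]` it is isomorphic to `ℚ[G]^{n-1} ⊕ ℚ` (regular representations plus one
trivial representation). -/
theorem chevalley_weil_for_graphs (n : ℕ) (hn : 2 ≤ n) (G : Type) [Group G] [Finite G]
    (q : FreeGroup (Fin n) →* G) (hq : Function.Surjective q) :
    ∃ ρ : G →* ((ℚ ⊗[ℤ] Additive (Abelianization q.ker)) ≃ₗ[ℚ]
        (ℚ ⊗[ℤ] Additive (Abelianization q.ker))),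
      (∀ (w k : FreeGroup (Fin n)) (hk : k ∈ q.ker),
        ρ (q w) (cls q ⟨k, hk⟩) =
          cls q ⟨w * k * w⁻¹, Subgroup.Normal.conj_mem inferInstance k hk w⟩) ∧
      Nonempty ((repOfAut ρ).asModule ≃ₗ[MonoidAlgebra ℚ G]
        ((Fin (n - 1) → MonoidAlgebra ℚ G) × (Representation.trivial ℚ (G := G) (V := ℚ)).asModule)) := by
  obtain ⟨e, he⟩ := cw_exists_equiv q hq
  let act : G →* (LinearMap.ker (cwBd q) ≃ₗ[ℚ] LinearMap.ker (cwBd q)) :=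
    { toFun := fun g =>
        { toFun := fun m => cwOf g • m
          map_add' := fun a b => smul_add _ a b
          map_smul' := fun r a => smul_comm _ _ _
          invFun := fun m => cwOf g⁻¹ • m
          left_inv := fun m => by
            beta_reduce
            rw [smul_smul, ← cwOf_mul, inv_mul_cancel, cwOf_one, one_smul]
          right_inv := fun m => by
            beta_reduce
            rw [smul_smul, ← cwOf_mul, mul_inv_cancel, cwOf_one, one_smul] }
      map_one' := by
        apply LinearEquiv.ext; intro m
        change cwOf (1 : G) • m = m
        rw [cwOf_one, one_smul]
      map_mul' := fun g h => by
        apply LinearEquiv.ext; intro m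
        change cwOf (g * h) • m = cwOf g • cwOf h • m
        rw [cwOf_mul, mul_smul] }
  let ρ : G →* ((ℚ ⊗[ℤ] Additive (Abelianization q.ker)) ≃ₗ[ℚ]
        (ℚ ⊗[ℤ] Additive (Abelianization q.ker))) :=
    { toFun := fun g => e.trans ((act g).trans e.symm)
      map_one' := by
        apply LinearEquiv.ext; intro m
        simp
      map_mul' := fun g h => by
        apply LinearEquiv.ext; intro m
        simp }
  have hρ : ∀ g v, e (ρ g v) = cwOf g • e v := fun g v => by
    change e (e.symm (cwOf g • e v)) = _
    rw [LinearEquiv.apply_symm_apply]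
  refine ⟨ρ, ?_, ?_⟩
  · intro w k hk
    apply e.injective
    rw [hρ]
    ext1
    rw [Submodule.coe_smul, he, he, cwD_conj q w k hk]
  · have hlin : ∀ (a : MonoidAlgebra ℚ G) (v : (repOfAut ρ).asModule),
        e ((repOfAut ρ).asModuleEquiv (a • v)) = a • e ((repOfAut ρ).asModuleEquiv v) := by
      intro a v
      rw [Representation.asModuleEquiv_map_smul]
      induction a using MonoidAlgebra.induction_linear with
      | zero => simp
      | add a b ha hb => rw [map_add, LinearMap.add_apply, map_add, ha, hb, add_smul]
      | single g r =>
        rw [Representation.asAlgebraHom_single, LinearMap.smul_apply, map_smul]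
        have h1 : (MonoidAlgebra.single g r : MonoidAlgebra ℚ G) = r • cwOf g := by
          simp [cwOf]
        rw [h1, smul_assoc, ← hρ]
        rfl
    have E1 : (repOfAut ρ).asModule ≃ₗ[MonoidAlgebra ℚ G] LinearMap.ker (cwBd q) :=
      { ((repOfAut ρ).asModuleEquiv.trans e).toAddEquiv with
        map_smul' := hlin }
    obtain ⟨m, rfl⟩ : ∃ m, n = m + 1 := ⟨n - 1, by omega⟩
    obtain ⟨E2⟩ := cw_split (cwBd q).rangeRestrict (LinearMap.surjective_rangeRestrict _)
    obtain ⟨E3⟩ := cw_split (cwAug G) cwAug_surj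
    have E4 := E3.trans (((LinearEquiv.ofEq _ _ (cw_ker_aug q hq)).prodCongr
      (LinearEquiv.refl (MonoidAlgebra ℚ G) _)).trans (LinearEquiv.prodComm _ _ _))
    have E2' := E2.trans ((LinearEquiv.ofEq _ _ (LinearMap.ker_rangeRestrict _)).prodCongr
      (LinearEquiv.refl (MonoidAlgebra ℚ G) _))
    have E5 : (Fin (m + 1) → MonoidAlgebra ℚ G) ≃ₗ[MonoidAlgebra ℚ G]
        ((Fin m → MonoidAlgebra ℚ G) × MonoidAlgebra ℚ G) :=
      (Fin.consLinearEquiv (MonoidAlgebra ℚ G) (fun _ => MonoidAlgebra ℚ G)).symm.trans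
        (LinearEquiv.prodComm _ _ _)
    have E6 := ((LinearEquiv.refl (MonoidAlgebra ℚ G)
      (Fin m → MonoidAlgebra ℚ G)).prodCongr E4).trans (LinearEquiv.prodAssoc _ _ _ _).symm
    have hfl : IsFiniteLength (MonoidAlgebra ℚ G) (LinearMap.range (cwBd q)) := by
      rw [isFiniteLength_iff_isNoetherian_isArtinian]
      exact ⟨inferInstance, inferInstance⟩
    obtain ⟨E7⟩ := cw_cancel hfl (E2'.symm.trans (E5.trans E6))
    exact ⟨E1.trans E7⟩
end

section
/- Suppose n ≥ 2. Then V is finite-dimensional over ℚ of dimension (n−1)·|G| + 1, i.e. finrank ℚ V = (n−1) * Fintype.card G + 1. -/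
open TensorProduct

namespace CoverAux

variable {n : ℕ} {G : Type} [Group G] (q : FreeGroup (Fin n) →* G)

/-- Cocycles on the free group with values in functions on `G`. -/
def Z : Submodule ℚ (FreeGroup (Fin n) → G → ℚ) where
  carrier := {c | ∀ w w' g, c (w * w') g = c w' g + c w (q w' * g)}
  add_mem' := by
    intro a b ha hb w w' g
    simp only [Pi.add_apply, ha w w' g, hb w w' g]
    ring
  zero_mem' := by
    intro w w' g
    simp
  smul_mem' := by
    intro t a ha w w' g
    simp only [Pi.smul_apply, smul_eq_mul, ha w w' g]
    ring

/-- Evaluation of cocycles on generators. -/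
def ev : Z q →ₗ[ℚ] (Fin n → G → ℚ) where
  toFun c := fun i g => c.1 (FreeGroup.of i) g
  map_add' _ _ := rfl
  map_smul' _ _ := rfl

variable {q} in
theorem Z_mul (c : Z q) (w w' : FreeGroup (Fin n)) (g : G) :
    c.1 (w * w') g = c.1 w' g + c.1 w (q w' * g) := c.2 w w' g

variable {q} in
theorem Z_one (c : Z q) (g : G) : c.1 1 g = 0 := by
  have h := Z_mul c 1 1 g
  simp only [mul_one, map_one, one_mul] at h
  linarith

theorem ev_inj : Function.Injective (ev q) := by
  rw [← LinearMap.ker_eq_bot, LinearMap.ker_eq_bot']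
  intro c hc
  have key : ∀ w : FreeGroup (Fin n), ∀ g, c.1 w g = 0 := by
    intro w
    induction w using FreeGroup.induction_on with
    | C1 => exact Z_one c
    | of i => intro g; exact congrFun (congrFun hc i) g
    | inv_of i ih =>
      intro g
      have h := Z_mul c (FreeGroup.of i) (FreeGroup.of i)⁻¹ g
      rw [mul_inv_cancel, Z_one, ih] at h
      linarith
    | mul x y hx hy =>
      intro g
      rw [Z_mul, hx, hy, add_zero]
  ext w g
  exact key w g

/-- The permutation attached to a generator. -/
def P (g₀ : G) (u : G → ℚ) : Equiv.Perm (G × ℚ) where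
  toFun p := (g₀ * p.1, p.2 + u p.1)
  invFun p := (g₀⁻¹ * p.1, p.2 - u (g₀⁻¹ * p.1))
  left_inv p := by ext <;> simp
  right_inv p := by ext <;> simp

theorem ev_surj : Function.Surjective (ev q) := by
  intro u
  let L : FreeGroup (Fin n) →* Equiv.Perm (G × ℚ) :=
    FreeGroup.lift fun i => P (q (FreeGroup.of i)) (u i)
  have hL : ∀ w, ∃ c : G → ℚ, ∀ g x, L w (g, x) = (q w * g, x + c g) := by
    intro w
    induction w using FreeGroup.induction_on with
    | C1 => exact ⟨0, fun g x => by simp⟩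
    | of i => exact ⟨u i, fun g x => by simp [L, P]⟩
    | inv_of i ih =>
      obtain ⟨c, hc⟩ := ih
      refine ⟨fun g => - c ((q (FreeGroup.of i))⁻¹ * g), fun g x => ?_⟩
      rw [map_inv, Equiv.Perm.inv_eq_iff_eq, hc]
      ext <;> simp
    | mul x y hx hy =>
      obtain ⟨c, hc⟩ := hx
      obtain ⟨d, hd⟩ := hy
      refine ⟨fun g => d g + c (q y * g), fun g t => ?_⟩
      rw [map_mul, Equiv.Perm.mul_apply, hd, hc, map_mul, mul_assoc, add_assoc]
  choose c hc using hL
  refine ⟨⟨c, ?_⟩, ?_⟩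
  · intro w w' g
    have h := hc (w * w') g 0
    rw [map_mul, Equiv.Perm.mul_apply, hc, hc] at h
    have h2 := congrArg Prod.snd h
    simp only [zero_add] at h2
    exact h2.symm
  · ext i g
    have h := congrArg Prod.snd (hc (FreeGroup.of i) g 0)
    simp only [L, FreeGroup.lift_apply_of, P, Equiv.coe_fn_mk, zero_add] at h
    exact h.symm

/-- Restriction of a cocycle to the kernel. -/
def res (c : Z q) : q.ker →* Multiplicative ℚ where
  toFun k := Multiplicative.ofAdd (c.1 k.1 1)
  map_one' := by
    rw [OneMemClass.coe_one, Z_one]; rfl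
  map_mul' k k' := by
    rw [Subgroup.coe_mul, Z_mul, MonoidHom.mem_ker.1 k'.2, one_mul, add_comm]; rfl

/-- Homs out of the kernel, as linear maps. -/
def toLin (f : q.ker →* Multiplicative ℚ) : Additive (Abelianization q.ker) →ₗ[ℤ] ℚ :=
  (MonoidHom.toAdditiveLeft (Abelianization.lift f)).toIntLinearMap

theorem toLin_of (f : q.ker →* Multiplicative ℚ) (k : q.ker) :
    toLin q f (Additive.ofMul (Abelianization.of k)) = (f k).toAdd := by
  rfl

theorem lin_ext {f g : Additive (Abelianization q.ker) →ₗ[ℤ] ℚ}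
    (h : ∀ k : q.ker, f (Additive.ofMul (Abelianization.of k)) =
      g (Additive.ofMul (Abelianization.of k))) : f = g := by
  ext x
  obtain ⟨k, hk⟩ := QuotientGroup.mk_surjective x.toMul
  have := h k
  have e : Additive.ofMul (Abelianization.of k) = x := hk
  rwa [e] at this

/-- Restriction as a linear map. -/
def r : Z q →ₗ[ℚ] (Additive (Abelianization q.ker) →ₗ[ℤ] ℚ) where
  toFun c := toLin q (res q c)
  map_add' a b := lin_ext q fun k => rfl
  map_smul' a b := lin_ext q fun k => rfl

theorem r_of (c : Z q) (k : q.ker) :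
    r q c (Additive.ofMul (Abelianization.of k)) = c.1 k.1 1 := rfl

/-- Coboundary. -/
def d : (G → ℚ) →ₗ[ℚ] Z q where
  toFun f := ⟨fun w g => f (q w * g) - f g, fun w w' g => by
    simp only [map_mul, mul_assoc]; ring⟩
  map_add' a b := by
    ext w g
    simp only [Pi.add_apply, Submodule.coe_add]; ring
  map_smul' a b := by
    ext w g
    simp only [Pi.smul_apply, Submodule.coe_smul, smul_eq_mul, RingHom.id_apply]; ring

theorem d_apply (f : G → ℚ) (w : FreeGroup (Fin n)) (g : G) :
    (d q f).1 w g = f (q w * g) - f g := rfl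

theorem ker_r (hq : Function.Surjective q) : LinearMap.ker (r q) = LinearMap.range (d q) := by
  ext c
  rw [LinearMap.mem_ker, LinearMap.mem_range]
  constructor
  · intro h
    have hk : ∀ k : FreeGroup (Fin n), q k = 1 → c.1 k 1 = 0 := by
      intro k hk
      rw [← r_of q c ⟨k, hk⟩, h]; rfl
    obtain ⟨s, hs⟩ := hq.hasRightInverse
    have hf : ∀ w, c.1 (s (q w)) 1 = c.1 w 1 := by
      intro w
      have h1 := Z_mul c w (w⁻¹ * s (q w)) 1
      have h2 : q (w⁻¹ * s (q w)) = 1 := by rw [map_mul, hs, map_inv, inv_mul_cancel]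
      rw [hk _ h2, h2, mul_inv_cancel_left, one_mul, zero_add] at h1
      exact h1
    refine ⟨fun g => c.1 (s g) 1, ?_⟩
    ext w g
    obtain ⟨v, rfl⟩ := hq g
    rw [d_apply, ← map_mul, hf, hf, Z_mul, mul_one]
    ring
  · rintro ⟨f, rfl⟩
    refine lin_ext q fun k => ?_
    rw [r_of, d_apply, MonoidHom.mem_ker.1 k.2]
    simp

theorem r_surj (hq : Function.Surjective q) : Function.Surjective (r q) := by
  intro φ
  obtain ⟨s, hs⟩ := hq.hasRightInverse
  have hm : ∀ (w : FreeGroup (Fin n)) (g : G), (s (q w * g))⁻¹ * w * s g ∈ q.ker := by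
    intro w g
    rw [MonoidHom.mem_ker]
    simp only [map_mul, map_inv, hs _]
    group
  let ψ : q.ker → ℚ := fun k => φ (Additive.ofMul (Abelianization.of k))
  have hψ : ∀ a b, ψ (a * b) = ψ a + ψ b := by
    intro a b
    simp only [ψ, map_mul, ofMul_mul, map_add]
  refine ⟨⟨fun w g => ψ ⟨_, hm w g⟩, ?_⟩, ?_⟩
  · intro w w' g
    change ψ _ = ψ _ + ψ _
    rw [add_comm, ← hψ]
    congr 1
    ext1
    simp only [Subgroup.coe_mul, map_mul, mul_assoc, mul_inv_cancel_left]
  · refine lin_ext q fun k => ?_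
    rw [r_of]
    change ψ _ = ψ k
    have h1 : s 1 ∈ q.ker := by rw [MonoidHom.mem_ker, hs]
    have e : (⟨s 1, h1⟩ : q.ker) * ⟨_, hm k.1 1⟩ = k * ⟨s 1, h1⟩ := by
      ext1
      simp [MonoidHom.mem_ker.1 k.2, mul_assoc]
    have := congrArg ψ e
    rw [hψ, hψ] at this
    linarith

theorem ker_d (hq : Function.Surjective q) :
    LinearMap.ker (d q) = Submodule.span ℚ {(1 : G → ℚ)} := by
  ext f
  rw [LinearMap.mem_ker, Submodule.mem_span_singleton]
  constructor
  · intro h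
    refine ⟨f 1, ?_⟩
    ext g
    obtain ⟨w, rfl⟩ := hq g
    have h1 := d_apply q f w 1
    rw [h, mul_one] at h1
    have h2 : (0 : ℚ) = f (q w) - f 1 := h1
    simp only [Pi.smul_apply, Pi.one_apply, smul_eq_mul, mul_one]
    linarith
  · rintro ⟨a, rfl⟩
    ext w g
    rw [d_apply]
    simp

end CoverAux

/-- Dimension count from Chevalley–Weil for graphs: for `n ≥ 2` and a surjection
`q : Fₙ → G` onto a finite group with kernel `K`, the rational first homology
`V = ℚ ⊗[ℤ] Kᵃᵇ` of the corresponding cover has dimension `(n-1)·|G| + 1`. -/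
theorem finrank_homology_of_cover (n : ℕ) (hn : 2 ≤ n) (G : Type) [Group G] [Fintype G]
    (q : FreeGroup (Fin n) →* G) (hq : Function.Surjective q) :
    Module.finrank ℚ (ℚ ⊗[ℤ] Additive (Abelianization q.ker)) =
      (n - 1) * Fintype.card G + 1 := by
  let e := LinearEquiv.ofBijective (CoverAux.ev q) ⟨CoverAux.ev_inj q, CoverAux.ev_surj q⟩
  haveI : Module.Finite ℚ (CoverAux.Z q) := Module.Finite.equiv e.symm
  have hZ : Module.finrank ℚ (CoverAux.Z q) = n * Fintype.card G := by
    rw [e.finrank_eq, Module.finrank_pi_fintype]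
    simp
  have h1 := LinearMap.finrank_range_add_finrank_ker (CoverAux.r q)
  have h2 := LinearMap.finrank_range_add_finrank_ker (CoverAux.d q)
  rw [CoverAux.ker_r q hq, LinearMap.range_eq_top.2 (CoverAux.r_surj q hq), finrank_top, hZ] at h1
  rw [CoverAux.ker_d q hq, finrank_span_singleton one_ne_zero, Module.finrank_fintype_fun_eq_card]
    at h2
  rw [← Subspace.dual_finrank_eq]
  have h3 := (LinearMap.liftBaseChangeEquiv (R := ℤ) (M := Additive (Abelianization q.ker))
    (N := ℚ) ℚ).finrank_eq
  unfold Module.Dual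
  rw [← h3]
  obtain ⟨m, rfl⟩ : ∃ m, n = m + 1 := ⟨n - 1, by omega⟩
  rw [add_mul, one_mul] at h1
  rw [Nat.add_sub_cancel]
  omega
end

section
/- There exist a finite group G, a surjective group homomorphism q : FreeGroup (Fin 2) →* G with kernel K, and a nonzero vector v ∈ V := ℚ ⊗[ℤ] Additive (Abelianization K), such that the set {φ̃ v : φ an automorphism of FreeGroup (Fin 2) with φ(K) = K} ⊆ V is finite, where φ̃ denotes the ℚ-linear automorphism of V induced by the restriction of φ to K. -/
open TensorProduct

/-- The restriction of an automorphism `φ` with `φ(K) = K` to an automorphism of `K`. -/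
def subgroupRestrict {F : Type*} [Group F] (K : Subgroup F) (φ : F ≃* F)
    (h : ∀ x : F, φ x ∈ K ↔ x ∈ K) : K ≃* K where
  toFun k := ⟨φ k, (h k).2 k.2⟩
  invFun k := ⟨φ.symm k, (h (φ.symm k)).1 (by rw [φ.apply_symm_apply]; exact k.2)⟩
  left_inv k := by ext; simp
  right_inv k := by ext; simp
  map_mul' x y := by ext; simp

/-- The induced `ℚ`-linear automorphism `φ̃` of `ℚ ⊗[ℤ] Kᵃᵇ`. -/
noncomputable def inducedAuto' {F : Type*} [Group F] (K : Subgroup F) (φ : F ≃* F)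
    (h : ∀ x : F, φ x ∈ K ↔ x ∈ K) :
    (ℚ ⊗[ℤ] Additive (Abelianization K)) ≃ₗ[ℚ] (ℚ ⊗[ℤ] Additive (Abelianization K)) :=
  LinearEquiv.baseChange ℤ ℚ _ _
    ((MulEquiv.toAdditive ((subgroupRestrict K φ h).abelianizationCongr)).toIntLinearEquiv)

namespace RankTwo

open scoped commutatorElement

/-- The free group on two generators. -/
abbrev F := FreeGroup (Fin 2)

/-- First generator. -/
def ga : F := FreeGroup.of 0
/-- Second generator. -/
def gb : F := FreeGroup.of 1

/-- The sign map `a ↦ -1`, `b ↦ 1`. -/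
def q : F →* ℤˣ := FreeGroup.lift ![-1, 1]

lemma q_a : q ga = -1 := by simp [q, ga]
lemma q_b : q gb = 1 := by simp [q, gb]

lemma ind {P : F → Prop} (h1 : P 1) (ha : P ga) (hb : P gb)
    (hinv : ∀ x, P x → P x⁻¹) (hmul : ∀ x y, P x → P y → P (x * y)) (x : F) : P x := by
  have hof : ∀ i : Fin 2, P (FreeGroup.of i) := by
    intro i
    fin_cases i
    · exact ha
    · exact hb
  induction x using FreeGroup.induction_on with
  | C1 => exact h1
  | of i => exact hof i
  | inv_of i h => exact hinv _ h
  | mul x y hx hy => exact hmul x y hx hy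

/-- The affine action on `ℤ`. -/
def D : F →* Equiv.Perm ℤ := FreeGroup.lift ![Equiv.neg ℤ, Equiv.addRight 1]

lemma D_a (n : ℤ) : D ga n = -n := by simp [D, ga]
lemma D_b (n : ℤ) : D gb n = n + 1 := by simp [D, gb]

lemma D_affine (x : F) : ∀ n m : ℤ, D x n - D x m = (q x : ℤ) * (n - m) := by
  induction x using ind with
  | h1 => simp
  | ha => intro n m; rw [D_a, D_a, q_a]; push_cast; ring
  | hb => intro n m; rw [D_b, D_b, q_b]; push_cast; ring
  | hinv x ih =>
    intro n m
    have := ih (D x⁻¹ n) (D x⁻¹ m)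
    have e : ∀ k, D x (D x⁻¹ k) = k := by intro k; simp
    rw [e, e] at this
    rw [this, ← mul_assoc, ← Units.val_mul, ← map_mul]
    simp
  | hmul x y hx hy =>
    intro n m
    rw [map_mul, Equiv.Perm.mul_apply, Equiv.Perm.mul_apply, hx, hy, map_mul, Units.val_mul]
    ring

/-- The homomorphism on the kernel. -/
def f : q.ker →* Multiplicative ℤ where
  toFun x := Multiplicative.ofAdd (D x 0)
  map_one' := by simp
  map_mul' x y := by
    have h := D_affine (x : F) (D y 0) 0
    rw [MonoidHom.mem_ker.1 x.2] at h
    rw [← ofAdd_add]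
    congr 1
    simp at h ⊢
    linarith

/-- The commutator of the generators. -/
def c : F := ga * gb * ga⁻¹ * gb⁻¹

lemma c_comm : c ∈ commutator F := by
  have := Subgroup.commutator_mem_commutator (Subgroup.mem_top ga) (Subgroup.mem_top gb)
  exact this

lemma comm_le : commutator F ≤ q.ker := by
  exact Abelianization.commutator_subset_ker q

lemma c_ker : c ∈ q.ker := comm_le c_comm

lemma f_c : f ⟨c, c_ker⟩ = Multiplicative.ofAdd (-2) := by
  have hbi : D gb⁻¹ 0 = -1 := by
    rw [map_inv, Equiv.Perm.inv_eq_iff_eq, D_b]; norm_num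
  have hai : D ga⁻¹ (-1) = 1 := by
    rw [map_inv, Equiv.Perm.inv_eq_iff_eq, D_a]
  have hc : D c 0 = -2 := by
    rw [c, map_mul, map_mul, map_mul, Equiv.Perm.mul_apply, Equiv.Perm.mul_apply,
      Equiv.Perm.mul_apply, hbi, hai, D_b, D_a]
    norm_num
  exact congrArg Multiplicative.ofAdd hc

/-- Quotient map by `[K,K]`. -/
def pr : F →* F ⧸ ⁅q.ker, q.ker⁆ := QuotientGroup.mk' _

lemma pr_eq_one {x : F} : pr x = 1 ↔ x ∈ ⁅q.ker, q.ker⁆ := by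
  exact QuotientGroup.eq_one_iff x

lemma pr_comm {x y : F} (hx : x ∈ q.ker) (hy : y ∈ q.ker) : pr x * pr y = pr y * pr x := by
  have h : pr ⁅x, y⁆ = 1 := pr_eq_one.2 (Subgroup.commutator_mem_commutator hx hy)
  rw [map_commutatorElement] at h
  exact commutatorElement_eq_one_iff_mul_comm.1 h

lemma conj_c (x : F) : pr x * pr c * (pr x)⁻¹ = pr c ^ (q x : ℤ) := by
  induction x using ind with
  | h1 => simp
  | ha =>
    rw [q_a]
    have h := pr_comm (x := ga * ga) (y := gb) (by simp [MonoidHom.mem_ker, q_a])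
      (by simp [MonoidHom.mem_ker, q_b])
    simp only [Units.val_neg, Units.val_one, zpow_neg, zpow_one]
    rw [eq_inv_iff_mul_eq_one]
    simp only [c, map_mul, map_inv] at h ⊢
    generalize pr ga = A at *
    generalize pr gb = B at *
    calc _ = (A * A * B) * A⁻¹ * A⁻¹ * B⁻¹ := by group
      _ = _ := by rw [h]; group
  | hb =>
    rw [q_b, pr_comm (by simp [MonoidHom.mem_ker, q_b]) c_ker]
    simp
  | hinv x ih =>
    have hq : (q x⁻¹ : ℤ) = q x := by
      rcases Int.units_eq_one_or (q x) with h | h <;> simp [h]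
    rw [hq, map_inv, inv_inv]
    have h2 : (q x : ℤ) * (q x : ℤ) = 1 := by
      rcases Int.units_eq_one_or (q x) with h | h <;> simp [h]
    have := congrArg (· ^ (q x : ℤ)) ih
    simp only [conj_zpow, ← zpow_mul, h2, zpow_one] at this
    conv_lhs => rw [← this]
    group
  | hmul x y hx hy =>
    calc _ = pr x * (pr y * pr c * (pr y)⁻¹) * (pr x)⁻¹ := by rw [map_mul]; group
      _ = _ := by rw [hy, ← conj_zpow, hx, ← zpow_mul, map_mul, Units.val_mul]

lemma comm_mem_zpowers {x : F} (hx : x ∈ commutator F) : ∃ n : ℤ, pr x = pr c ^ n := by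
  let N : Subgroup F := (Subgroup.zpowers (pr c)).comap pr
  have hN : N.Normal := ⟨by
    rintro n ⟨k, hk⟩ g
    refine ⟨(q g : ℤ) * k, ?_⟩
    simp only at hk ⊢
    rw [map_mul, map_mul, map_inv, ← hk, ← conj_zpow, conj_c, ← zpow_mul]⟩
  have hab : Commute (QuotientGroup.mk' N ga) (QuotientGroup.mk' N gb) := by
    have h : QuotientGroup.mk' N ⁅ga, gb⁆ = 1 :=
      (QuotientGroup.eq_one_iff _).2 (Subgroup.mem_zpowers (pr c))
    rw [map_commutatorElement] at h
    exact commutatorElement_eq_one_iff_mul_comm.1 h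
  have key : ∀ z : F ⧸ N, Commute (QuotientGroup.mk' N ga) z → Commute (QuotientGroup.mk' N gb) z →
      ∀ x : F, Commute (QuotientGroup.mk' N x) z := by
    intro z h1 h2 x
    induction x using ind with
    | h1 => rw [map_one]; exact Commute.one_left _
    | ha => exact h1
    | hb => exact h2
    | hinv x ih => rw [map_inv]; exact ih.inv_left
    | hmul x y hx hy => rw [map_mul]; exact hx.mul_left hy
  have ka := key _ (Commute.refl _) hab.symm
  have kb := key _ hab (Commute.refl _)
  have hle : commutator F ≤ N := by
    rw [commutator_def, Subgroup.commutator_le]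
    intro x _ y _
    refine (QuotientGroup.eq_one_iff _).1 ?_
    change QuotientGroup.mk' N ⁅x, y⁆ = 1
    rw [map_commutatorElement]
    exact commutatorElement_eq_one_iff_mul_comm.2 (key _ (ka y).symm (kb y).symm x)
  obtain ⟨n, hn⟩ := hle hx
  exact ⟨n, hn.symm⟩

lemma of_eq {x : F} (hx : x ∈ commutator F) : ∃ n : ℤ,
    (Abelianization.of (⟨x, comm_le hx⟩ : q.ker)) =
      (Abelianization.of (⟨c, c_ker⟩ : q.ker)) ^ n := by
  obtain ⟨n, hn⟩ := comm_mem_zpowers hx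
  refine ⟨n, ?_⟩
  have h1 : x * (c ^ n)⁻¹ ∈ ⁅q.ker, q.ker⁆ := by
    rw [← pr_eq_one, map_mul, map_inv, map_zpow, hn, mul_inv_cancel]
  rw [← Subgroup.map_subtype_commutator] at h1
  obtain ⟨y, hy, hyx⟩ := h1
  have hy' : y = (⟨x, comm_le hx⟩ : q.ker) * ((⟨c, c_ker⟩ : q.ker) ^ n)⁻¹ := by
    ext; simpa using hyx
  have h3 : Abelianization.of y = 1 := by
    rw [← MonoidHom.mem_ker, Abelianization.ker_of]; exact hy
  rw [hy', map_mul, map_inv, map_zpow, mul_inv_eq_one] at h3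
  exact h3

/-- The class of `c`. -/
def cc : Abelianization q.ker := Abelianization.of ⟨c, c_ker⟩

lemma exists_pow (φ : F ≃* F) (h : ∀ x : F, φ x ∈ q.ker ↔ x ∈ q.ker) :
    ∃ n : ℤ, (subgroupRestrict q.ker φ h).abelianizationCongr cc = cc ^ n := by
  have hx : φ c ∈ commutator F := by
    have := map_commutatorElement φ.toMonoidHom ga gb
    change φ ⁅ga, gb⁆ ∈ _
    rw [map_commutatorElement]
    exact Subgroup.commutator_mem_commutator (Subgroup.mem_top _) (Subgroup.mem_top _)
  obtain ⟨n, hn⟩ := of_eq hx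
  exact ⟨n, hn⟩

lemma cc_f : Abelianization.lift f cc = Multiplicative.ofAdd (-2) := by
  rw [cc, Abelianization.lift_apply_of, f_c]

lemma pow_unit (φ : F ≃* F) (h : ∀ x : F, φ x ∈ q.ker ↔ x ∈ q.ker) :
    (subgroupRestrict q.ker φ h).abelianizationCongr cc = cc ∨
    (subgroupRestrict q.ker φ h).abelianizationCongr cc = cc⁻¹ := by
  have h' : ∀ x : F, φ.symm x ∈ q.ker ↔ x ∈ q.ker := fun x => by
    rw [← h, φ.apply_symm_apply]
  obtain ⟨n, hn⟩ := exists_pow φ h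
  obtain ⟨m, hm⟩ := exists_pow φ.symm h'
  have h1 : (subgroupRestrict q.ker φ.symm h').abelianizationCongr
      ((subgroupRestrict q.ker φ h).abelianizationCongr cc) = cc := by
    have : (subgroupRestrict q.ker φ.symm h') (subgroupRestrict q.ker φ h ⟨c, c_ker⟩)
        = ⟨c, c_ker⟩ := Subtype.ext (φ.symm_apply_apply c)
    exact congrArg Abelianization.of this
  rw [hn, map_zpow, hm, ← zpow_mul] at h1
  have h2 := congrArg (Abelianization.lift f) h1
  rw [map_zpow, cc_f, ← ofAdd_zsmul] at h2
  have h3 : (m * n) • (-2 : ℤ) = -2 := Multiplicative.ofAdd.injective h2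
  have h4 : n * m = 1 := by
    simp only [smul_eq_mul] at h3; linarith
  rcases Int.eq_one_or_neg_one_of_mul_eq_one h4 with e | e
  · left; rw [hn, e, zpow_one]
  · right; rw [hn, e, zpow_neg, zpow_one]

/-- The linear functional to `ℤ`. -/
noncomputable def fl : Additive (Abelianization q.ker) →ₗ[ℤ] ℤ :=
  (MonoidHom.toAdditiveLeft (Abelianization.lift f)).toIntLinearMap

lemma fl_cc : fl (Additive.ofMul cc) = -2 := congrArg Multiplicative.toAdd cc_f

end RankTwo

/-- Lemma 3.1: Theorem 1.1 fails in rank 2. There are a finite group `G`, a surjection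
`q : F₂ → G` with kernel `K`, and a nonzero vector `v ∈ V = ℚ ⊗ Kᵃᵇ` whose orbit under
all induced automorphisms `φ̃` with `φ(K) = K` is finite. -/
theorem rank_two_counterexample :
    ∃ (G : Type) (_ : Group G) (_ : Finite G) (q : FreeGroup (Fin 2) →* G),
      Function.Surjective q ∧
      ∃ v : ℚ ⊗[ℤ] Additive (Abelianization q.ker), v ≠ 0 ∧
        {w : ℚ ⊗[ℤ] Additive (Abelianization q.ker) |
          ∃ (φ : FreeGroup (Fin 2) ≃* FreeGroup (Fin 2))
            (h : ∀ x : FreeGroup (Fin 2), φ x ∈ q.ker ↔ x ∈ q.ker),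
            inducedAuto' q.ker φ h v = w}.Finite := by
  refine ⟨ℤˣ, inferInstance, inferInstance, RankTwo.q, ?_,
    (1 : ℚ) ⊗ₜ[ℤ] Additive.ofMul RankTwo.cc, ?_, ?_⟩
  · intro u
    rcases Int.units_eq_one_or u with rfl | rfl
    · exact ⟨1, map_one _⟩
    · exact ⟨RankTwo.ga, RankTwo.q_a⟩
  · intro h0
    have h1 := congrArg (TensorProduct.rid ℤ ℚ) (congrArg (LinearMap.lTensor ℚ RankTwo.fl) h0)
    rw [LinearMap.lTensor_tmul, RankTwo.fl_cc, TensorProduct.rid_tmul, map_zero, map_zero] at h1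
    norm_num at h1
  · refine Set.Finite.subset (Set.toFinite
      {(1 : ℚ) ⊗ₜ[ℤ] Additive.ofMul RankTwo.cc, (1 : ℚ) ⊗ₜ[ℤ] Additive.ofMul RankTwo.cc⁻¹}) ?_
    rintro w ⟨φ, h, rfl⟩
    have e : inducedAuto' RankTwo.q.ker φ h ((1 : ℚ) ⊗ₜ[ℤ] Additive.ofMul RankTwo.cc) =
        (1 : ℚ) ⊗ₜ[ℤ] Additive.ofMul
          ((subgroupRestrict RankTwo.q.ker φ h).abelianizationCongr RankTwo.cc) := rfl
    rw [e]
    rcases RankTwo.pow_unit φ h with h1 | h1 <;> rw [h1]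
    · exact Or.inl rfl
    · exact Or.inr rfl
end

section
/- For every automorphism φ of FreeGroup (Fin 2), the image φ(c) of the commutator c = a * b * a⁻¹ * b⁻¹ of the two generators is conjugate in FreeGroup (Fin 2) to c or to c⁻¹; that is, there exists u ∈ FreeGroup (Fin 2) such that φ(c) = u * c * u⁻¹ or φ(c) = u * c⁻¹ * u⁻¹. -/
namespace NielsenAux

open FreeGroup

abbrev G := FreeGroup (Fin 2)

/-- Length of the longest common prefix. -/
def lcp : List (Fin 2 × Bool) → List (Fin 2 × Bool) → ℕ
  | [], _ => 0
  | _ :: _, [] => 0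
  | a :: A, b :: B => if a = b then lcp A B + 1 else 0

lemma lcp_comm : ∀ A B, lcp A B = lcp B A
  | [], [] => rfl
  | [], _ :: _ => rfl
  | _ :: _, [] => rfl
  | a :: A, b :: B => by
    simp only [lcp, lcp_comm A B, eq_comm (a := a)]

lemma lcp_hyp : ∀ A B C, min (lcp A B) (lcp B C) ≤ lcp A C
  | [], _, _ => by simp [lcp]
  | _ :: _, [], _ => by simp [lcp]
  | _ :: _, _ :: _, [] => by simp [lcp]
  | a :: A, b :: B, c :: C => by
    have := lcp_hyp A B C
    simp only [lcp]
    split_ifs <;> simp_all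

lemma isReduced_invRev {L : List (Fin 2 × Bool)} (h : IsReduced L) : IsReduced (invRev L) := by
  rw [isReduced_iff_reduce_eq] at *
  rw [reduce_invRev, h]

lemma norm_mk_of_isReduced {L : List (Fin 2 × Bool)} (h : IsReduced L) :
    norm (mk L) = L.length := by
  rw [FreeGroup.norm, toWord_mk, h.reduce_eq]

lemma norm_lcp : ∀ A B : List (Fin 2 × Bool), IsReduced A → IsReduced B →
    norm ((mk A)⁻¹ * mk B) + 2 * lcp A B = A.length + B.length
  | [], B, _, hB => by
    have : (mk [] : G) = 1 := rfl
    simp [lcp, this, norm_mk_of_isReduced hB]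
  | a :: A, [], hA, _ => by
    have : (mk [] : G) = 1 := rfl
    rw [this, mul_one, norm_inv_eq, norm_mk_of_isReduced hA]
    simp [lcp]
  | a :: A, b :: B, hA, hB => by
    by_cases hab : a = b
    · subst hab
      have ih := norm_lcp A B (hA.infix (List.suffix_cons a A).isInfix)
        (hB.infix (List.suffix_cons a B).isInfix)
      have e1 : (mk (a :: A) : G) = mk [a] * mk A := by rw [mul_mk]; rfl
      have e2 : (mk (a :: B) : G) = mk [a] * mk B := by rw [mul_mk]; rfl
      have e : (mk (a :: A))⁻¹ * (mk (a :: B) : G) = (mk A)⁻¹ * mk B := by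
        rw [e1, e2]; group
      rw [e]
      simp only [lcp, if_true, List.length_cons]
      omega
    · have hr : IsReduced (invRev (a :: A) ++ b :: B) := by
        have h1 := isReduced_invRev hA
        have h2 : invRev (a :: A) = invRev A ++ [(a.1, !a.2)] := by simp [invRev]
        rw [h2] at h1 ⊢
        apply IsReduced.append_overlap h1 _ (by simp)
        rw [List.singleton_append, FreeGroup.isReduced_cons_cons]
        refine ⟨fun h => ?_, hB⟩
        by_contra h3
        apply hab
        ext1
        · exact h
        · revert h3; cases a.2 <;> cases b.2 <;> simp
      rw [inv_mk, mul_mk, norm_mk_of_isReduced hr]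
      simp [lcp, hab]

/-- Gromov product. -/
def gp (u v : G) : ℕ := lcp u.toWord v.toWord

lemma gp_comm (u v : G) : gp u v = gp v u := lcp_comm _ _
lemma gp_hyp (u v w : G) : min (gp u v) (gp v w) ≤ gp u w := lcp_hyp _ _ _
lemma norm_gp (u v : G) : norm (u⁻¹ * v) + 2 * gp u v = norm u + norm v := by
  have := norm_lcp u.toWord v.toWord isReduced_toWord isReduced_toWord
  rwa [mk_toWord, mk_toWord] at this
lemma norm_gp_inv (u v : G) : norm (u * v) + 2 * gp u⁻¹ v = norm u + norm v := by
  have := norm_gp u⁻¹ v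
  rwa [inv_inv, norm_inv_eq] at this

lemma exists_split (x : G) (k : ℕ) (hk : k ≤ norm x) :
    ∃ p q : G, x = p * q ∧ norm p = k ∧ norm q = norm x - k := by
  have hr : IsReduced x.toWord := isReduced_toWord
  refine ⟨mk (x.toWord.take k), mk (x.toWord.drop k), ?_, ?_, ?_⟩
  · rw [mul_mk, List.take_append_drop, mk_toWord]
  · rw [norm_mk_of_isReduced (hr.infix (List.take_prefix _ _).isInfix), List.length_take]
    exact min_eq_left hk
  · rw [norm_mk_of_isReduced (hr.infix (List.drop_suffix _ _).isInfix), List.length_drop]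
    rfl

lemma self_cancel (x : G) (hx : x ≠ 1) : 2 * gp x⁻¹ x < norm x := by
  by_contra! h
  obtain ⟨p, q, e, hp, hq⟩ := exists_split x ((norm x + 1) / 2) (by
    have : norm x ≠ 0 := fun h => hx (norm_eq_zero.1 h)
    omega)
  have h1 := norm_gp p x
  rw [show p⁻¹ * x = q by rw [e]; group] at h1
  have h2 := norm_gp q⁻¹ x⁻¹
  rw [show q⁻¹⁻¹ * x⁻¹ = p⁻¹ by rw [e]; group, norm_inv_eq, norm_inv_eq, norm_inv_eq] at h2
  have h4 := gp_hyp p x x⁻¹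
  have h5 := gp_hyp p x⁻¹ q⁻¹
  have h6 := gp_comm x x⁻¹
  have h7 := gp_comm q⁻¹ x⁻¹
  have h8 := norm_gp p x⁻¹
  have h9 := norm_gp p q⁻¹
  rw [norm_inv_eq] at h8 h9
  obtain ⟨z, hz⟩ : ∃ z, z = p⁻¹ * q⁻¹ := ⟨_, rfl⟩
  have hqz : q = z⁻¹ * p⁻¹ := by rw [hz]; group
  have hz1 : z = 1 := by
    rw [← hz] at h9
    have e1 : p⁻¹ * x⁻¹ = z * p⁻¹ := by rw [e, hz]; group
    rw [e1] at h8
    have h10 := norm_gp z⁻¹ p⁻¹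
    have h11 := norm_gp z p⁻¹
    rw [inv_inv, norm_inv_eq, norm_inv_eq] at h10
    rw [← hqz, norm_inv_eq] at h11
    have h12 := gp_hyp z p⁻¹ z⁻¹
    have h13 := gp_comm p⁻¹ z⁻¹
    have h14 := norm_gp z⁻¹ z
    have h15 := gp_comm z z⁻¹
    rw [inv_inv, norm_inv_eq] at h14
    by_contra hne
    have h16 : norm z ≠ 0 := fun h => hne (norm_eq_zero.1 h)
    have h17 : norm (z * z) ≠ 0 := fun h => by
      have := norm_eq_zero.1 h
      rw [← pow_two] at this
      exact hne ((pow_eq_one_iff_left (by norm_num)).1 this)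
    omega
  apply hx
  rw [e, hqz, hz1]
  group

/-- The commutator. -/
def K (x y : G) : G := x * y * x⁻¹ * y⁻¹

def good (z : G) : Prop :=
  ∃ u : G, z = u * K (of 0) (of 1) * u⁻¹ ∨ z = u * (K (of 0) (of 1))⁻¹ * u⁻¹

lemma good.inv {z : G} (h : good z) : good z⁻¹ := by
  obtain ⟨u, h | h⟩ := h
  · exact ⟨u, Or.inr (by rw [h]; group)⟩
  · exact ⟨u, Or.inl (by rw [h]; group)⟩

lemma good.conj {z : G} (h : good z) (g : G) : good (g * z * g⁻¹) := by
  obtain ⟨u, h | h⟩ := h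
  · exact ⟨g * u, Or.inl (by rw [h]; group)⟩
  · exact ⟨g * u, Or.inr (by rw [h]; group)⟩

def Gen (x y : G) : Prop := ∀ H : Subgroup G, x ∈ H → y ∈ H → ∀ z, z ∈ H

/-- Generating pair that is a counterexample. -/
def Q (x y : G) : Prop := Gen x y ∧ ¬ good (K x y)

lemma Q.swap {x y : G} (h : Q x y) : Q y x := by
  refine ⟨fun H hy hx => h.1 H hx hy, fun hg => h.2 ?_⟩
  have := hg.inv
  rwa [show (K y x)⁻¹ = K x y by simp only [K]; group] at this

lemma Q.inv_left {x y : G} (h : Q x y) : Q x⁻¹ y := by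
  refine ⟨fun H hx hy => h.1 H (by simpa using hx) hy, fun hg => h.2 ?_⟩
  have := (hg.conj x).inv
  rwa [show (x * K x⁻¹ y * x⁻¹)⁻¹ = K x y by simp only [K]; group] at this

lemma Q.mul_left {x y : G} (h : Q x y) : Q (x * y) y := by
  refine ⟨fun H hx hy => h.1 H ((H.mul_mem_cancel_right hy).1 hx) hy, fun hg => h.2 ?_⟩
  rwa [show K (x * y) y = K x y by simp only [K]; group] at hg

lemma Q.conj {x y : G} (h : Q x y) (g : G) : Q (g * x * g⁻¹) (g * y * g⁻¹) := by
  refine ⟨fun H hx hy z => ?_, fun hg => h.2 ?_⟩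
  · have := h.1 (H.comap (MulAut.conj g).toMonoidHom) (by simpa using hx) (by simpa using hy)
      (g⁻¹ * z * g)
    simpa [mul_assoc] using this
  · have := hg.conj g⁻¹
    rwa [show g⁻¹ * K (g * x * g⁻¹) (g * y * g⁻¹) * g⁻¹⁻¹ = K x y by
      simp only [K]; group] at this

lemma Q.right_ne_one {x y : G} (h : Q x y) : y ≠ 1 := by
  rintro rfl
  have hx : ∀ z, z ∈ Subgroup.centralizer {x} := h.1 _
    (by simp [Subgroup.mem_centralizer_iff]) (one_mem _)
  have hc : ∀ z, z ∈ Subgroup.center G := h.1 _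
    (by
      rw [Subgroup.mem_center_iff]
      intro g
      have := Subgroup.mem_centralizer_iff.1 (hx g) x rfl
      exact this.symm) (one_mem _)
  have := Subgroup.mem_center_iff.1 (hc (of 0)) (of 1)
  revert this
  decide

/-- Minimal counterexample. -/
def M (x y : G) : Prop := Q x y ∧ ∀ x' y', Q x' y' → norm x + norm y ≤ norm x' + norm y'

lemma M.swap {x y : G} (h : M x y) : M y x :=
  ⟨h.1.swap, fun x' y' h' => by have := h.2 x' y' h'; omega⟩

lemma M.inv_left {x y : G} (h : M x y) : M x⁻¹ y :=
  ⟨h.1.inv_left, fun x' y' h' => by have := h.2 x' y' h'; rwa [norm_inv_eq]⟩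

lemma M.inv_right {x y : G} (h : M x y) : M x y⁻¹ := h.swap.inv_left.swap

lemma M.n1_right {x y : G} (h : M x y) : 2 * gp x⁻¹ y ≤ norm y := by
  have h1 := h.2 _ _ h.1.mul_left
  have h2 := norm_gp_inv x y
  omega

lemma M.n1_left {x y : G} (h : M x y) : 2 * gp x⁻¹ y ≤ norm x := by
  have := h.swap.inv_left.inv_right.n1_right
  rwa [inv_inv, gp_comm, FreeGroup.norm_inv_eq] at this

lemma M.n2_inv {x y : G} (h : M x y) : gp x⁻¹ y + gp y⁻¹ x⁻¹ < norm y := by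
  have h1 := h.n1_right
  have h2 := h.swap.inv_right.n1_left
  have h3 := self_cancel y h.1.right_ne_one
  have h4 := gp_hyp y⁻¹ x⁻¹ y
  omega

lemma M.n2_same {x y : G} (h : M x y) : gp x⁻¹ y + gp y⁻¹ x < norm y := by
  have h1 := h.n1_right
  have h2 := h.swap.n1_left
  have h3 := h.n1_left
  have h0 : norm y ≠ 0 := fun h' => h.1.right_ne_one (norm_eq_zero.1 h')
  by_contra! hc
  obtain ⟨p, q, e, hp, hq⟩ := exists_split y (norm y / 2) (by omega)
  have h4 := norm_gp p y
  rw [show p⁻¹ * y = q by rw [e]; group] at h4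
  have h5 := norm_gp q⁻¹ y⁻¹
  rw [show q⁻¹⁻¹ * y⁻¹ = p⁻¹ by rw [e]; group, norm_inv_eq, norm_inv_eq, norm_inv_eq] at h5
  have h6 := gp_hyp x⁻¹ y p
  have h7 := gp_hyp q⁻¹ y⁻¹ x
  have h8 := gp_comm y p
  have h9 := norm_gp_inv q x
  have h10 := norm_gp (q * x)⁻¹ p
  have h11 := gp_hyp (q * x)⁻¹ x⁻¹ p
  have h12 := norm_gp (q * x)⁻¹ x⁻¹
  rw [show (q * x)⁻¹⁻¹ * x⁻¹ = q by group, norm_inv_eq, norm_inv_eq] at h12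
  rw [inv_inv, norm_inv_eq] at h10
  have h13 := h.2 _ _ (h.1.mul_left.conj q)
  rw [show q * (x * y) * q⁻¹ = q * x * p by rw [e]; group,
    show q * y * q⁻¹ = q * p by rw [e]; group] at h13
  have h14 := norm_mul_le q p
  omega

/-- Image of a letter. -/
def val (x y : G) (s : Fin 2 × Bool) : G := cond s.2 (![x, y] s.1) (![x, y] s.1)⁻¹

lemma M.val {x y : G} (h : M x y) (s t : Fin 2 × Bool) (hst : s.1 ≠ t.1) :
    M (val x y s) (val x y t) := by
  obtain ⟨i, b⟩ := s
  obtain ⟨j, c⟩ := t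
  have h1 := h.inv_left
  have h2 := h.inv_right
  have h3 := h.inv_left.inv_right
  have g0 := h.swap
  have g1 := h1.swap
  have g2 := h2.swap
  have g3 := h3.swap
  fin_cases i <;> fin_cases j <;> cases b <;> cases c <;> simp_all [NielsenAux.val]

lemma val_eq_or (x y : G) (s t : Fin 2 × Bool) (hst : s.1 = t.1) :
    (s = t) ∨ (s.2 ≠ t.2 ∧ val x y s = (val x y t)⁻¹) := by
  obtain ⟨i, b⟩ := s
  obtain ⟨j, c⟩ := t
  simp only at hst
  subst hst
  cases b <;> cases c <;> simp [val]

lemma M.ne_one {x y : G} (h : M x y) (s : Fin 2 × Bool) : NielsenAux.val x y s ≠ 1 :=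
  (h.val (s.1 + 1, true) s (by simp)).1.right_ne_one

lemma M.c1 {x y : G} (h : M x y) (s t : Fin 2 × Bool) (hst : s.1 = t.1 → s.2 = t.2) :
    2 * gp (NielsenAux.val x y s)⁻¹ (NielsenAux.val x y t) ≤ norm (NielsenAux.val x y s) ∧
    2 * gp (NielsenAux.val x y s)⁻¹ (NielsenAux.val x y t) ≤ norm (NielsenAux.val x y t) := by
  by_cases h1 : s.1 = t.1
  · have : s = t := Prod.ext h1 (hst h1)
    subst this
    have := self_cancel _ (h.ne_one s)
    omega
  · exact ⟨(h.val s t h1).n1_left, (h.val s t h1).n1_right⟩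

lemma M.c2 {x y : G} (h : M x y) (r s t : Fin 2 × Bool) (hrs : r.1 = s.1 → r.2 = s.2)
    (hst : s.1 = t.1 → s.2 = t.2) :
    gp (NielsenAux.val x y r)⁻¹ (NielsenAux.val x y s) +
      gp (NielsenAux.val x y s)⁻¹ (NielsenAux.val x y t) < norm (NielsenAux.val x y s) := by
  have a1 := h.c1 r s hrs
  have a2 := h.c1 s t hst
  have a3 := self_cancel _ (h.ne_one s)
  by_cases h1 : r.1 = s.1
  · have : r = s := Prod.ext h1 (hrs h1)
    subst this
    omega
  by_cases h2 : s.1 = t.1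
  · have : s = t := Prod.ext h2 (hst h2)
    subst this
    omega
  have h3 : t.1 = r.1 := by omega
  obtain rfl | ⟨_, h4⟩ := val_eq_or x y t r h3
  · exact (h.val t s h1).n2_same
  · rw [h4]
    exact (h.val r s h1).n2_inv

lemma M.chain {x y : G} (h : M x y) : ∀ (L : List (Fin 2 × Bool)) (s : Fin 2 × Bool),
    IsReduced (s :: L) →
    (∀ r : Fin 2 × Bool, (r.1 = s.1 → r.2 = s.2) →
      gp (NielsenAux.val x y r)⁻¹ (((s :: L).map (NielsenAux.val x y)).prod) =
        gp (NielsenAux.val x y r)⁻¹ (NielsenAux.val x y s)) ∧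
    norm (NielsenAux.val x y s) ≤ norm (((s :: L).map (NielsenAux.val x y)).prod) ∧
    (L ≠ [] → 2 ≤ norm (((s :: L).map (NielsenAux.val x y)).prod))
  | [], s, _ => by simp
  | t :: L, s, hr => by
    rw [isReduced_cons_cons] at hr
    obtain ⟨i1, i2, -⟩ := h.chain L t hr.2
    have i3 := i1 s hr.1
    rw [List.map_cons, List.prod_cons]
    generalize ((t :: L).map (NielsenAux.val x y)).prod = P at *
    have b1 := h.c1 s t hr.1
    have b2 := norm_gp_inv (NielsenAux.val x y s) P
    have n1 : norm (NielsenAux.val x y s) ≠ 0 := fun h' => h.ne_one s (norm_eq_zero.1 h')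
    have n2 : norm (NielsenAux.val x y t) ≠ 0 := fun h' => h.ne_one t (norm_eq_zero.1 h')
    refine ⟨fun r hrs => ?_, by omega, fun _ => by omega⟩
    have b3 := h.c2 r s t hrs hr.1
    have b4 := norm_gp (NielsenAux.val x y s) (NielsenAux.val x y s * P)
    rw [inv_mul_cancel_left] at b4
    have b5 := gp_hyp (NielsenAux.val x y r)⁻¹ (NielsenAux.val x y s) (NielsenAux.val x y s * P)
    have b6 := gp_hyp (NielsenAux.val x y r)⁻¹ (NielsenAux.val x y s * P) (NielsenAux.val x y s)
    have b7 := gp_comm (NielsenAux.val x y s) (NielsenAux.val x y s * P)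
    omega

lemma M.letter {x y : G} (h : M x y) (i : Fin 2) : ∃ s, of i = NielsenAux.val x y s := by
  obtain ⟨w, hw⟩ := h.1.1 (FreeGroup.lift ![x, y]).range ⟨of 0, by simp⟩ ⟨of 1, by simp⟩ (of i)
  rw [← mk_toWord (x := w), lift_mk] at hw
  change (w.toWord.map (NielsenAux.val x y)).prod = of i at hw
  have hr : IsReduced w.toWord := isReduced_toWord
  generalize w.toWord = L at *
  match L, hr, hw with
  | [], _, hw => exact absurd hw (one_ne_of i)
  | [s], _, hw => exact ⟨s, by simpa using hw.symm⟩
  | s :: t :: L, hr, hw =>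
    have := (h.chain (t :: L) s hr).2.2 (by simp)
    rw [hw, norm_of] at this
    omega

lemma not_M {x y : G} (h : M x y) : False := by
  obtain ⟨s, hs⟩ := h.letter 0
  obtain ⟨t, ht⟩ := h.letter 1
  by_cases hst : s.1 = t.1
  · obtain rfl | ⟨_, h1⟩ := val_eq_or x y s t hst
    · rw [← ht] at hs
      revert hs; decide
    · rw [← hs, ← ht] at h1
      revert h1; decide
  · have := (h.val s t hst).1.2
    rw [← hs, ← ht] at this
    exact this ⟨1, Or.inl (by group)⟩

lemma not_Q : ∀ (n : ℕ) (x y : G), norm x + norm y = n → ¬ Q x y := by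
  intro n
  induction n using Nat.strong_induction_on with
  | _ n ih =>
    intro x y hn hq
    refine not_M (x := x) (y := y) ⟨hq, fun x' y' h' => ?_⟩
    by_contra! hlt
    exact ih _ (hn ▸ hlt) x' y' rfl h'

end NielsenAux

/-- Nielsen's classical fact, used in Section 3.1: every automorphism of the free group
`F₂` on generators `a = FreeGroup.of 0`, `b = FreeGroup.of 1` sends the commutator
`c = a b a⁻¹ b⁻¹` to a conjugate of `c` or of `c⁻¹`. -/
theorem aut_commutator_conj (φ : FreeGroup (Fin 2) ≃* FreeGroup (Fin 2)) :
    ∃ u : FreeGroup (Fin 2),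
      φ (FreeGroup.of 0 * FreeGroup.of 1 * (FreeGroup.of 0)⁻¹ * (FreeGroup.of 1)⁻¹) =
          u * (FreeGroup.of 0 * FreeGroup.of 1 * (FreeGroup.of 0)⁻¹ * (FreeGroup.of 1)⁻¹)
            * u⁻¹ ∨
        φ (FreeGroup.of 0 * FreeGroup.of 1 * (FreeGroup.of 0)⁻¹ * (FreeGroup.of 1)⁻¹) =
          u * (FreeGroup.of 0 * FreeGroup.of 1 * (FreeGroup.of 0)⁻¹ * (FreeGroup.of 1)⁻¹)⁻¹
            * u⁻¹ := by
  have hgen : NielsenAux.Gen (φ (FreeGroup.of 0)) (φ (FreeGroup.of 1)) := by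
    intro H h0 h1 z
    have key : H.comap φ.toMonoidHom = ⊤ := by
      rw [eq_top_iff, ← FreeGroup.closure_range_of, Subgroup.closure_le]
      rintro _ ⟨i, rfl⟩
      fin_cases i
      · exact h0
      · exact h1
    have hz : φ.symm z ∈ H.comap φ.toMonoidHom := by rw [key]; trivial
    simpa using hz
  have hgood : NielsenAux.good (NielsenAux.K (φ (FreeGroup.of 0)) (φ (FreeGroup.of 1))) := by
    by_contra hb
    exact NielsenAux.not_Q _ _ _ rfl ⟨hgen, hb⟩
  simp only [map_mul, map_inv]
  exact hgood
end
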